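/- arXiv:2005.04944 — 9 statements merged into one kernel-verified Lean document; each statement's English description precedes it below -/
import Mathlib

section
/- Let k be a field of characteristic 0 and σ a ring automorphism of the polynomial ring k[t]. For all nonzero f, g ∈ k[t] there exist nonzero polynomials a, b, c ∈ k[t] such that: f·b·c = g·a·σ(c) (i.e., f/g = (a/b)·(σ(c)/c) in the fraction field k(t)); spr_σ(a, b) = ∅; gcd(a, c) = 1; and gcd(b, σ(c)) = 1. -/
open Finset Polynomial

theorem IsCoprime.of_map_ringEquiv {R S : Type*} [CommSemiring R] [CommSemiring S] (e : R ≃+* S)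
    {x y : R} (h : IsCoprime (e x) (e y)) : IsCoprime x y := by
  simpa using h.map (e.symm : S →+* R)

theorem RingAut.pow_succ_apply {R : Type*} [CommSemiring R] (σ : RingAut R) (n : ℕ) (x : R) :
    (σ ^ (n + 1)) x = σ ((σ ^ n) x) := by
  rw [pow_succ', RingAut.mul_apply]

theorem RingAut.pow_add_apply {R : Type*} [CommSemiring R] (σ : RingAut R) (m n : ℕ) (x : R) :
    (σ ^ (m + n)) x = (σ ^ m) ((σ ^ n) x) := by
  rw [pow_add, RingAut.mul_apply]

theorem RingAut.map_prod_pow_mul {R : Type*} [CommSemiring R] (σ : RingAut R) (e : R) (m : ℕ) :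
    σ (∏ j ∈ Finset.range m, (σ ^ j) e) * e = (∏ j ∈ Finset.range m, (σ ^ j) e) * (σ ^ m) e := by
  rw [← Finset.prod_range_succ, Finset.prod_range_succ', map_prod]
  simp only [RingAut.pow_succ_apply, pow_zero, RingAut.one_apply]

/-- Gosper's algorithm over a principal ideal domain: common factors of `a` and `σ ^ m b` are
cancelled in order of increasing `m`, so each cancelled factor is coprime to what remains. -/
theorem RingAut.exists_normal_form {R : Type*} [CommRing R] [IsDomain R] [IsPrincipalIdealRing R]
    (σ : RingAut R) (a : R) (ha : a ≠ 0) (b : R) (hb : b ≠ 0) :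
    ∃ A B C : R, A ∣ a ∧ B ∣ b ∧ C ≠ 0 ∧ a * B * C = b * A * σ C ∧
      (∀ m : ℕ, IsCoprime A ((σ ^ m) B)) ∧ IsCoprime A C ∧ IsCoprime B (σ C) := by
  classical
  induction a using (wellFounded_dvdNotUnit (α := R)).induction generalizing b with
  | _ a ih =>
  by_cases hspread : ∀ m : ℕ, IsCoprime a ((σ ^ m) b)
  · exact ⟨a, b, 1, dvd_rfl, dvd_rfl, one_ne_zero, by simp [mul_comm], hspread,
      isCoprime_one_right, by simpa using isCoprime_one_right⟩
  push Not at hspread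
  obtain ⟨m, hm, hmin⟩ : ∃ m, ¬ IsCoprime a ((σ ^ m) b) ∧
      ∀ j < m, IsCoprime a ((σ ^ j) b) :=
    ⟨Nat.find hspread, Nat.find_spec hspread, fun j hj => not_not.1 (Nat.find_min hspread hj)⟩
  obtain ⟨d, hd, hda, hdb⟩ : ∃ d, ¬ IsUnit d ∧ d ∣ a ∧ d ∣ (σ ^ m) b := by
    by_contra! h
    exact hm (isCoprime_of_dvd _ _ (fun h0 => ha h0.1) fun z hz _ => h z hz)
  obtain ⟨e, rfl⟩ := (σ ^ m).surjective d
  obtain ⟨b', rfl⟩ : e ∣ b := (map_dvd_iff (σ ^ m)).1 hdb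
  obtain ⟨a', rfl⟩ := hda
  have ha' : a' ≠ 0 := right_ne_zero_of_mul ha
  have he : e ≠ 0 := left_ne_zero_of_mul hb
  obtain ⟨A, B, C, hA, hB, hC, heq, hs, hAC, hBC⟩ :=
    ih a' ⟨ha', _, hd, mul_comm _ _⟩ ha' b' (right_ne_zero_of_mul hb)
  refine ⟨A, B, C * ∏ j ∈ Finset.range m, (σ ^ j) e, hA.mul_left _, hB.mul_left _,
    mul_ne_zero hC (Finset.prod_ne_zero_iff.2 fun j _ =>
      (map_ne_zero_iff _ (σ ^ j).injective).2 he), ?_, hs,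
    hAC.mul_right (IsCoprime.prod_right fun j hj => ?_), ?_⟩
  · have key := RingAut.map_prod_pow_mul σ e m
    rw [map_mul]
    linear_combination ((∏ j ∈ Finset.range m, (σ ^ j) e) * (σ ^ m) e) * heq
      - b' * A * σ C * key
  · refine (hmin j (Finset.mem_range.1 hj)).mono (hA.mul_left _) ?_
    exact (map_dvd_iff (σ ^ j)).2 (dvd_mul_right _ _)
  · rw [map_mul, map_prod]
    refine hBC.mul_right (IsCoprime.prod_right fun j hj => ?_)
    have hj := Finset.mem_range.1 hj
    obtain ⟨i, rfl⟩ := Nat.exists_eq_add_of_lt hj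
    rw [← RingAut.pow_succ_apply]
    refine IsCoprime.of_map_ringEquiv (σ ^ i) ?_
    rw [← RingAut.pow_add_apply, show i + (j + 1) = j + i + 1 by omega]
    exact ((hmin i (by omega)).mono (dvd_mul_right _ _)
      ((map_dvd_iff (σ ^ i)).2 (hB.mul_left _))).symm

/-- Theorem `PNF`, parts (i)-(iii): normal form for rational functions. Given a ring
automorphism `σ` of `k[t]` and nonzero `f, g ∈ k[t]`, there exist nonzero `a, b, c ∈ k[t]`
with `f/g = (a/b)·(σ(c)/c)` (cleared of denominators: `f·b·c = g·a·σ(c)`),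
`spr_σ(a,b) = ∅`, `gcd(a,c) = 1` and `gcd(b,σ(c)) = 1`. -/
theorem rational_normal_form {k : Type*} [Field k] [CharZero k]
    (σ : RingAut (Polynomial k))
    (f g : Polynomial k) (hf : f ≠ 0) (hg : g ≠ 0) :
    ∃ a b c : Polynomial k, a ≠ 0 ∧ b ≠ 0 ∧ c ≠ 0 ∧
      f * b * c = g * a * σ c ∧
      {m : ℕ | ¬ IsCoprime a ((σ ^ m) b)} = ∅ ∧
      IsCoprime a c ∧
      IsCoprime b (σ c) := by
  obtain ⟨a, b, c, ha, hb, hc, heq, hs, hac, hbc⟩ := RingAut.exists_normal_form σ f hf g hg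
  exact ⟨a, b, c, ne_zero_of_dvd_ne_zero hf ha, ne_zero_of_dvd_ne_zero hg hb, hc, heq,
    Set.eq_empty_of_forall_notMem fun m hm => hm (hs m), hac, hbc⟩
end

section
/- Let k be a field of characteristic 0 and σ a ring automorphism of the polynomial ring k[t] such that every semi-periodic element of k[t] is semi-invariant. Then for all nonzero f, g ∈ k[t] there exist nonzero polynomials a, b, c ∈ k[t] such that: f·b·c = g·a·σ(c) (i.e., f/g = (a/b)·(σ(c)/c) in k(t)); spr_σ(a, b) = ∅; gcd(a, c) = 1; gcd(b, σ(c)) = 1; and moreover the spread spr_σ(c, c) is a finite set. -/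
open Finset Polynomial

namespace Polynomial

variable {k : Type*} [Field k]

theorem exists_ringAut_C (s : RingAut k[X]) : ∃ τ : k →+* k, ∀ x, s (C x) = C (τ x) := by
  refine ⟨constantCoeff.comp ((s : k[X] →+* k[X]).comp C), fun x => ?_⟩
  rcases eq_or_ne x 0 with rfl | hx
  · simp
  · have hu : IsUnit (s (C x)) := (isUnit_C.2 hx.isUnit).map s
    obtain ⟨r, -, hr⟩ := isUnit_iff.1 hu
    simp [← hr]

theorem ringAut_eq_map_comp (s : RingAut k[X]) {τ : k →+* k} (hτ : ∀ x, s (C x) = C (τ x))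
    (p : k[X]) : s p = (p.map τ).comp (s X) := by
  have h : (s : k[X] →+* k[X]) = (compRingHom (s X)).comp (mapRingHom τ) := by
    ext x
    · simp [hτ]
    · simp
  exact congrArg (fun φ : k[X] →+* k[X] => φ p) h

theorem natDegree_ringAut_X (s : RingAut k[X]) : (s X).natDegree = 1 := by
  obtain ⟨τ, hτ⟩ := exists_ringAut_C s
  have h := congrArg natDegree (ringAut_eq_map_comp s hτ (s.symm X))
  rw [RingEquiv.apply_symm_apply, natDegree_X, natDegree_comp] at h
  exact Nat.eq_one_of_mul_eq_one_left h.symm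

theorem natDegree_ringAut (s : RingAut k[X]) (p : k[X]) : (s p).natDegree = p.natDegree := by
  obtain ⟨τ, hτ⟩ := exists_ringAut_C s
  rw [ringAut_eq_map_comp s hτ, natDegree_comp, natDegree_ringAut_X, natDegree_map, mul_one]

theorem leadingCoeff_ringAut (s : RingAut k[X]) {τ : k →+* k} (hτ : ∀ x, s (C x) = C (τ x))
    (p : k[X]) :
    (s p).leadingCoeff = τ p.leadingCoeff * (s X).leadingCoeff ^ p.natDegree := by
  rw [ringAut_eq_map_comp s hτ, leadingCoeff_comp (by simp [natDegree_ringAut_X]),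
    leadingCoeff_map, natDegree_map]

theorem derivative_ringAut (s : RingAut k[X]) (p : k[X]) :
    derivative (s p) = C (s X).leadingCoeff * s (derivative p) := by
  obtain ⟨τ, hτ⟩ := exists_ringAut_C s
  have hX : derivative (s X) = C (s X).leadingCoeff := by
    conv_lhs => rw [eq_X_add_C_of_natDegree_le_one (natDegree_ringAut_X s).le]
    simp [leadingCoeff, natDegree_ringAut_X]
  rw [ringAut_eq_map_comp s hτ p, derivative_comp, hX, derivative_map,
    ringAut_eq_map_comp s hτ (derivative p)]

theorem exists_ringAut_X_sub_C_eq [CharZero k] (s : RingAut k[X]) (d : ℕ) (p : k[X]) (v : k)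
    (hd : p.natDegree = d + 1) (hp : s p = C v * p) :
    ∃ β w, s (X - C β) = C w * (X - C β) := by
  have hA : (s X).leadingCoeff ≠ 0 := by simp
  induction d generalizing p v with
  | zero =>
    obtain ⟨τ, hτ⟩ := exists_ringAut_C s
    obtain ⟨e, β, he, rfl⟩ : ∃ e β, e ≠ 0 ∧ p = C e * (X - C β) := by
      have he : p.coeff 1 ≠ 0 := by
        have : p.leadingCoeff ≠ 0 := by
          rw [leadingCoeff_ne_zero]
          rintro rfl
          simp at hd
        simpa [leadingCoeff, hd] using this
      refine ⟨p.coeff 1, -p.coeff 0 / p.coeff 1, he, ?_⟩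
      conv_lhs => rw [eq_X_add_C_of_natDegree_le_one (p := p) (by omega)]
      rw [mul_sub, ← C_mul, mul_div_cancel₀ _ he]
      simp
    have hτe : τ e ≠ 0 := by simpa using he
    refine ⟨β, v * e / τ e, mul_left_cancel₀ (C_ne_zero.2 hτe) ?_⟩
    rw [← mul_assoc, ← C_mul, mul_div_cancel₀ _ hτe, C_mul, mul_assoc, ← hp, map_mul, hτ]
  | succ d ih =>
    refine ih (derivative p) ((s X).leadingCoeff⁻¹ * v) ?_ ?_
    · rw [natDegree_derivative, hd]; rfl
    · have h := congrArg derivative hp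
      rw [derivative_ringAut, derivative_C_mul] at h
      rw [C_mul, mul_assoc, ← h, ← mul_assoc, ← C_mul, inv_mul_cancel₀ hA]
      simp

/-- An irreducible polynomial that is not semi-invariant, but becomes so under a power of `σ`,
has a multiplier which is a coboundary. -/
theorem exists_ringAut_pow_C_eq [CharZero k] (σ : RingAut k[X]) (n : ℕ) {p : k[X]}
    (hirr : Irreducible p) {v : k} (hp : (σ ^ n) p = C v * p) (hσ : ¬ Associated (σ p) p) :
    ∃ μ, μ ≠ 0 ∧ (σ ^ n) (C μ) = C v * C μ := by
  have hcomm : ∀ q, (σ ^ n) (σ q) = σ ((σ ^ n) q) := fun q => by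
    rw [← RingAut.mul_apply, ← RingAut.mul_apply, ← pow_succ, ← pow_succ']
  set s := σ ^ n
  obtain ⟨τ, hτ⟩ := exists_ringAut_C s
  obtain ⟨ρ, hρ⟩ := exists_ringAut_C σ
  obtain ⟨ρ', hρ'⟩ := exists_ringAut_C σ.symm
  have hdeg := hirr.natDegree_pos
  obtain ⟨β, w, hw⟩ := exists_ringAut_X_sub_C_eq s (p.natDegree - 1) p v (by omega) hp
  obtain ⟨a, b, hab⟩ : ∃ a b, σ (X - C β) = C a * (X - C β) + C b := by
    have h := eq_X_add_C_of_natDegree_le_one (natDegree_ringAut_X σ).le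
    refine ⟨(σ X).coeff 1, (σ X).coeff 0 - ρ β + (σ X).coeff 1 * β, ?_⟩
    rw [map_sub, hρ]
    conv_lhs => rw [h]
    simp only [C_add, C_sub, C_mul]
    ring
  by_cases hb : b = 0
  · have hβ : p.eval β ≠ 0 := by
      intro h
      have hass : Associated (X - C β) p :=
        (irreducible_X_sub_C β).associated_of_dvd hirr (dvd_iff_isRoot.2 h)
      refine hσ ((hass.symm.map σ).trans (Associated.trans ?_ hass))
      rw [hab, hb, C_0, add_zero]
      refine associated_unit_mul_left _ _ (isUnit_C.2 (IsUnit.mk0 _ ?_))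
      rintro rfl
      have : σ (X - C β) = 0 := by simp [hab, hb]
      exact X_sub_C_ne_zero β ((map_eq_zero_iff σ σ.injective).1 this)
    refine ⟨p.eval β, hβ, ?_⟩
    obtain ⟨q, hq⟩ := X_sub_C_dvd_sub_C_eval (a := β) (p := p)
    have h := congrArg (eval β) (congrArg s hq)
    rw [map_sub, hp, hτ, map_mul, hw] at h
    simp only [eval_sub, eval_mul, eval_C, eval_X, sub_self, mul_zero, zero_mul] at h
    rw [hτ, ← C_mul, sub_eq_zero.1 h]
  · obtain ⟨y, hy⟩ : ∃ y, σ (C y) = C b := ⟨ρ' b, by rw [← hρ', RingEquiv.apply_symm_apply]⟩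
    have hy0 : y ≠ 0 := by
      rintro rfl
      exact hb (by simpa using hy.symm)
    have h := congrArg (eval β) (hcomm (X - C β))
    rw [hw, map_mul, hab, map_add, map_mul, hτ, hτ, hw, hρ] at h
    simp only [eval_add, eval_sub, eval_mul, eval_C, eval_X, sub_self, mul_zero, zero_add] at h
    have hyw : s (C y) = C w * C y := by
      apply σ.injective
      rw [← hcomm, hy, hτ, map_mul, hy, hρ, h, C_mul]
    have hτy : τ y = w * y := by
      rw [hτ, ← C_mul] at hyw
      exact C_injective hyw
    have hwX : (s X).leadingCoeff = w := by
      have h1 := leadingCoeff_ringAut s hτ (X - C β)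
      rw [hw] at h1
      simpa using h1.symm
    have hv := leadingCoeff_ringAut s hτ p
    rw [hp, hwX, leadingCoeff_mul, leadingCoeff_C] at hv
    refine ⟨p.leadingCoeff * y ^ p.natDegree,
      mul_ne_zero (leadingCoeff_ne_zero.2 hirr.ne_zero) (pow_ne_zero _ hy0), ?_⟩
    rw [hτ, ← C_mul, map_mul, map_pow, hτy, mul_pow, ← mul_assoc, ← hv, mul_assoc]

theorem associated_ringAut_of_pow [CharZero k] (σ : RingAut k[X])
    (hsemi : ∀ p : k[X],
      (∃ n : ℕ, 0 < n ∧ ∃ u : k[X], IsUnit u ∧ (σ ^ n) p = u ^ n * p) →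
      ∃ u : k[X], IsUnit u ∧ σ p = u * p)
    {n : ℕ} (hn : 0 < n) {p : k[X]} (hirr : Irreducible p) (hp : Associated ((σ ^ n) p) p) :
    Associated (σ p) p := by
  by_contra hσ
  obtain ⟨u, hu⟩ := hp.symm
  obtain ⟨v, -, hv⟩ := isUnit_iff.1 u.isUnit
  rw [← hv, mul_comm] at hu
  obtain ⟨μ, hμ, h⟩ := exists_ringAut_pow_C_eq σ n hirr hu.symm hσ
  have hunit : IsUnit (C μ⁻¹ : k[X]) := isUnit_C.2 (inv_ne_zero hμ).isUnit
  have hμ' : (C μ : k[X]) * C μ⁻¹ = 1 := by rw [← C_mul, mul_inv_cancel₀ hμ, C_1]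
  have hfix : (σ ^ n) (C μ⁻¹ * p) = C μ⁻¹ * p := by
    have h1 : C v * C μ * (σ ^ n) (C μ⁻¹) = 1 := by rw [← h, ← map_mul, hμ', map_one]
    rw [map_mul, ← hu]
    linear_combination (C μ⁻¹ * p) * h1 - (C v * (σ ^ n) (C μ⁻¹) * p) * hμ'
  obtain ⟨w, hw, hwp⟩ := hsemi (C μ⁻¹ * p) ⟨n, hn, 1, isUnit_one, by rw [hfix]; simp⟩
  have e1 : Associated (C μ⁻¹ * p) p := associated_unit_mul_left _ _ hunit
  exact hσ ((e1.symm.map σ).trans (by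
    rw [hwp]
    exact (associated_unit_mul_left _ _ hw).trans e1))

theorem associated_ringAut_iff (s : RingAut k[X]) {p q : k[X]} :
    Associated (s p) (s q) ↔ Associated p q :=
  ⟨fun h => by simpa using h.map s.symm, fun h => h.map s⟩

theorem irreducible_ringAut_iff (s : RingAut k[X]) {p : k[X]} :
    Irreducible (s p) ↔ Irreducible p :=
  MulEquiv.irreducible_iff s

theorem exists_irreducible_dvd_of_not_isCoprime {p q : k[X]} (hp : p ≠ 0)
    (h : ¬ IsCoprime p q) : ∃ r, Irreducible r ∧ r ∣ p ∧ r ∣ q := by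
  by_contra! H
  exact h (isCoprime_of_irreducible_dvd (fun h' => hp h'.1) H)

theorem finite_setOf_not_isCoprime_ringAut_pow [CharZero k] (σ : RingAut k[X])
    (hsemi : ∀ p : k[X],
      (∃ n : ℕ, 0 < n ∧ ∃ u : k[X], IsUnit u ∧ (σ ^ n) p = u ^ n * p) →
      ∃ u : k[X], IsUnit u ∧ σ p = u * p)
    {c : k[X]} (hc : c ≠ 0)
    (hP : ∀ r, Irreducible r → r ∣ c → ¬ Associated (σ r) r) :
    Set.Finite {m : ℕ | ¬ IsCoprime c ((σ ^ m) c)} := by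
  classical
  set F := (UniqueFactorizationMonoid.normalizedFactors c).toFinset
  have hfin : Set.Finite (⋃ p ∈ F, ⋃ q ∈ F, {m : ℕ | Associated ((σ ^ m) p) q}) := by
    refine Set.Finite.biUnion F.finite_toSet fun p hp => ?_
    refine Set.Finite.biUnion F.finite_toSet fun q _ => Set.Subsingleton.finite ?_
    have hp' : p ∈ UniqueFactorizationMonoid.normalizedFactors c :=
      Multiset.mem_toFinset.1 hp
    have hirr := UniqueFactorizationMonoid.irreducible_of_normalized_factor p hp'
    have hdvd := UniqueFactorizationMonoid.dvd_of_mem_normalizedFactors hp'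
    have key : ∀ m n : ℕ, m < n → Associated ((σ ^ m) p) q → ¬ Associated ((σ ^ n) p) q := by
      intro m n hmn hm hn
      refine hP p hirr hdvd
        (associated_ringAut_of_pow σ hsemi (Nat.sub_pos_of_lt hmn) hirr ?_)
      rw [← associated_ringAut_iff (σ ^ m), ← RingAut.mul_apply, ← pow_add,
        Nat.add_sub_cancel' hmn.le]
      exact hn.trans hm.symm
    intro m hm n hn
    rcases lt_trichotomy m n with h | h | h
    · exact absurd hn (key m n h hm)
    · exact h
    · exact absurd hm (key n m h hn)
  refine hfin.subset fun m hm => ?_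
  obtain ⟨r, hr, hrc, hrσ⟩ := exists_irreducible_dvd_of_not_isCoprime hc hm
  obtain ⟨q, hq, hrq⟩ :=
    UniqueFactorizationMonoid.exists_mem_normalizedFactors_of_dvd hc hr hrc
  have hr' : Irreducible ((σ ^ m).symm r) := (irreducible_ringAut_iff (σ ^ m).symm).2 hr
  have hrc' : (σ ^ m).symm r ∣ c := by
      simpa only [RingEquiv.symm_apply_apply] using _root_.map_dvd (σ ^ m).symm hrσ
  obtain ⟨p, hp, hrp⟩ :=
    UniqueFactorizationMonoid.exists_mem_normalizedFactors_of_dvd hc hr' hrc'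
  simp only [Set.mem_iUnion]
  refine ⟨p, Multiset.mem_toFinset.2 hp, q, Multiset.mem_toFinset.2 hq, ?_⟩
  have := hrp.symm.map (σ ^ m)
  rw [RingEquiv.apply_symm_apply] at this
  exact this.trans hrq

theorem exists_normal_form_of_eq (σ : RingAut k[X]) {f g : k[X]} (a b c : k[X])
    (ha : a ≠ 0) (hb : b ≠ 0) (hc : c ≠ 0) (h : f * b * c = g * a * σ c)
    (hP : ∀ r, Irreducible r → r ∣ c → ¬ Associated (σ r) r) :
    ∃ a b c : k[X], a ≠ 0 ∧ b ≠ 0 ∧ c ≠ 0 ∧ f * b * c = g * a * σ c ∧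
      (∀ m : ℕ, IsCoprime a ((σ ^ m) b)) ∧ IsCoprime a c ∧ IsCoprime b (σ c) ∧
      ∀ r, Irreducible r → r ∣ c → ¬ Associated (σ r) r := by
  by_cases h1 : ∀ m : ℕ, IsCoprime a ((σ ^ m) b)
  swap
  · push Not at h1
    obtain ⟨m, hm⟩ := h1
    obtain ⟨p, hp, ⟨a', rfl⟩, hpb⟩ := exists_irreducible_dvd_of_not_isCoprime ha hm
    obtain ⟨q, rfl⟩ := (σ ^ m).surjective p
    have hq : Irreducible q := (irreducible_ringAut_iff _).1 hp
    obtain ⟨b', rfl⟩ : q ∣ b := by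
      simpa only [RingEquiv.symm_apply_apply] using _root_.map_dvd (σ ^ m).symm hpb
    have ha' := right_ne_zero_of_mul ha
    have hb' := right_ne_zero_of_mul hb
    have hdq := hq.natDegree_pos
    have hdp := hp.natDegree_pos
    have hda := natDegree_mul hp.ne_zero ha'
    have hdb := natDegree_mul hq.ne_zero hb'
    by_cases hσ : Associated (σ q) q
    · have hqm : ∀ i : ℕ, Associated q ((σ ^ i) q) := by
        intro i
        induction i with
        | zero => simp
        | succ i ih =>
          rw [pow_succ', RingAut.mul_apply]
          exact hσ.symm.trans (ih.map σ)
      obtain ⟨u, hu⟩ := hqm m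
      have hdu : natDegree ((u : k[X]) * a') = natDegree a' := by
        rw [natDegree_mul u.ne_zero ha', natDegree_eq_zero_of_isUnit u.isUnit, zero_add]
      exact exists_normal_form_of_eq σ ((u : k[X]) * a') b' c (mul_ne_zero u.ne_zero ha') hb' hc
        (mul_left_cancel₀ hq.ne_zero (by rw [← hu] at h; linear_combination h)) hP
    · set d := ∏ i ∈ range m, (σ ^ i) q with hd
      have hd0 : d ≠ 0 := prod_ne_zero_iff.2 fun i _ =>
        ((irreducible_ringAut_iff (σ ^ i)).2 hq).ne_zero
      have hdd : q * σ d = d * (σ ^ m) q := by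
        rw [hd, map_prod, ← prod_range_succ, prod_range_succ', mul_comm]
        simp only [pow_succ', RingAut.mul_apply, pow_zero, RingAut.one_apply]
      refine exists_normal_form_of_eq σ a' b' (c * d) ha' hb' (mul_ne_zero hc hd0)
        (mul_left_cancel₀ hq.ne_zero ?_) fun r hr hrd hσr => ?_
      · rw [map_mul]
        linear_combination d * h - (g * a' * σ c) * hdd
      · rcases hr.prime.dvd_or_dvd hrd with hrc | hrd
        · exact hP r hr hrc hσr
        · obtain ⟨i, -, hi⟩ := (hr.prime.dvd_finsetProd_iff _).1 hrd
          have hri := hr.associated_of_dvd ((irreducible_ringAut_iff (σ ^ i)).2 hq) hi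
          apply hσ
          rw [← associated_ringAut_iff (σ ^ i), ← RingAut.mul_apply, ← pow_succ, pow_succ',
            RingAut.mul_apply]
          exact (hri.symm.map σ).trans (hσr.trans hri)
  by_cases h2 : IsCoprime a c
  swap
  · obtain ⟨p, hp, ⟨a', rfl⟩, ⟨c', rfl⟩⟩ := exists_irreducible_dvd_of_not_isCoprime ha h2
    have ha' := right_ne_zero_of_mul ha
    have hc' := right_ne_zero_of_mul hc
    have hσp := (irreducible_ringAut_iff σ).2 hp
    have hdp := hp.natDegree_pos
    have hda := natDegree_mul hp.ne_zero ha'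
    have hda' := natDegree_mul hσp.ne_zero ha'
    have hdc := natDegree_mul hp.ne_zero hc'
    have hdσ := natDegree_ringAut σ p
    exact exists_normal_form_of_eq σ (σ p * a') b c' (mul_ne_zero hσp.ne_zero ha') hb hc'
      (mul_left_cancel₀ hp.ne_zero (by rw [map_mul] at h; linear_combination h))
      fun r hr hrc => hP r hr (hrc.mul_left p)
  by_cases h3 : IsCoprime b (σ c)
  swap
  · obtain ⟨p, hp, hpb, hpc⟩ := exists_irreducible_dvd_of_not_isCoprime hb h3
    obtain ⟨q, rfl⟩ := σ.surjective p
    obtain ⟨b', rfl⟩ := hpb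
    obtain ⟨c', rfl⟩ : q ∣ c := by simpa using _root_.map_dvd σ.symm hpc
    have hq : Irreducible q := (irreducible_ringAut_iff _).1 hp
    have hb' := right_ne_zero_of_mul hb
    have hc' := right_ne_zero_of_mul hc
    have hdq := hq.natDegree_pos
    have hdb := natDegree_mul hp.ne_zero hb'
    have hdb' := natDegree_mul hq.ne_zero hb'
    have hdc := natDegree_mul hq.ne_zero hc'
    have hdσ := natDegree_ringAut σ q
    exact exists_normal_form_of_eq σ a (q * b') c' ha (mul_ne_zero hq.ne_zero hb') hc'
      (mul_left_cancel₀ hp.ne_zero (by rw [map_mul] at h; linear_combination h))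
      fun r hr hrc => hP r hr (hrc.mul_left q)
  exact ⟨a, b, c, ha, hb, hc, h, h1, h2, h3, hP⟩
termination_by (a.natDegree + b.natDegree, c.natDegree)
decreasing_by
  all_goals simp only [Prod.lex_def]; subst_vars; omega

end Polynomial

/-- Theorem `PNF`, including part (iv): normal form for rational functions with finite
spread of `c`. Here `σ` is a ring automorphism of `k[t]` such that every semi-periodic
element of `k[t]` (i.e. `σ^n(p) = u^n·p` for some `n > 0` and unit `u`) is semi-invariant
(i.e. `σ(p) = u·p` for some unit `u`). -/
theorem rational_normal_form_finite_spread {k : Type*} [Field k] [CharZero k]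
    (σ : RingAut (Polynomial k))
    (hsemi : ∀ p : Polynomial k,
      (∃ n : ℕ, 0 < n ∧ ∃ u : Polynomial k, IsUnit u ∧ (σ ^ n) p = u ^ n * p) →
      ∃ u : Polynomial k, IsUnit u ∧ σ p = u * p)
    (f g : Polynomial k) (hf : f ≠ 0) (hg : g ≠ 0) :
    ∃ a b c : Polynomial k, a ≠ 0 ∧ b ≠ 0 ∧ c ≠ 0 ∧
      f * b * c = g * a * σ c ∧
      {m : ℕ | ¬ IsCoprime a ((σ ^ m) b)} = ∅ ∧
      IsCoprime a c ∧
      IsCoprime b (σ c) ∧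
      Set.Finite {m : ℕ | ¬ IsCoprime c ((σ ^ m) c)} := by
  obtain ⟨a, b, c, ha, hb, hc, h, h1, h2, h3, hP⟩ :=
    exists_normal_form_of_eq σ (f := f) (g := g) f g 1 hf hg one_ne_zero (by rw [map_one]; ring)
      (fun r hr hr1 => absurd (isUnit_of_dvd_one hr1) hr.not_isUnit)
  exact ⟨a, b, c, ha, hb, hc, h, Set.eq_empty_iff_forall_notMem.2 fun m hm => hm (h1 m), h2, h3,
    finite_setOf_not_isCoprime_ringAut_pow σ hsemi hc hP⟩
end

section
/- Let (k, σ) be a difference field, K a field extension of k, σ_K a field automorphism of K with σ_K(u) = σ(u) for all u ∈ k, and t ∈ K nonzero. Then the following are equivalent: (a) t is a Π-monomial over k, i.e., t is transcendental over k, σ_K(t)/t ∈ k, and every element y of the intermediate field k(t) ⊆ K with σ_K(y) = y lies in Const_σ(k); (b) σ_K(t)/t ∈ k and σ_K(t)/t is not a σ-radical over k. -/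
open Polynomial in
/-- The `σ`-semilinear endomorphism of `k[X]` sending `X` to `α X`. -/
noncomputable def twist {k : Type*} [Field k] (σ : RingAut k) (α : k) (P : k[X]) : k[X] :=
  (P.map (σ : k →+* k)).comp (C α * X)

open Polynomial in
theorem coeff_twist {k : Type*} [Field k] (σ : RingAut k) (α : k) (P : k[X]) (i : ℕ) :
    (twist σ α P).coeff i = σ (P.coeff i) * α ^ i := by
  simp [twist, comp_C_mul_X_coeff]

open Polynomial in
theorem map_aeval_eq_aeval_twist {k K : Type*} [Field k] [Field K] [Algebra k K]
    {σ : RingAut k} {σK : RingAut K}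
    (hcompat : ∀ u : k, σK (algebraMap k K u) = algebraMap k K (σ u))
    {t : K} {α : k} (hα : σK t = algebraMap k K α * t) (P : k[X]) :
    σK (aeval t P) = aeval t (twist σ α P) := by
  induction P using Polynomial.induction_on' with
  | add p q hp hq => simp_all [twist]
  | monomial n a =>
    simp [twist, ← C_mul_X_pow_eq_monomial, hcompat, hα]

theorem eq_of_semi_invariant {k : Type*} [Field k] {σ : RingAut k} {α : k} (hα : α ≠ 0)
    (hrad : ¬ ∃ g : k, g ≠ 0 ∧ ∃ n : ℕ, 1 ≤ n ∧ σ g = α ^ n * g)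
    {c : k} (hc : c ≠ 0) {i n : ℕ} (h : σ c * α ^ i = α ^ n * c) : i = n := by
  rcases lt_trichotomy i n with hlt | heq | hgt
  · refine absurd ⟨c, hc, n - i, by omega, ?_⟩ hrad
    obtain ⟨d, rfl⟩ := Nat.exists_eq_add_of_le hlt.le
    apply mul_right_cancel₀ (pow_ne_zero i hα)
    rw [h, Nat.add_sub_cancel_left]
    ring
  · exact heq
  · refine absurd ⟨c⁻¹, inv_ne_zero hc, i - n, by omega, ?_⟩ hrad
    obtain ⟨d, rfl⟩ := Nat.exists_eq_add_of_le hgt.le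
    have hσ : σ c ≠ 0 := by simpa using hc
    have h2 : σ c * α ^ d = c := by
      apply mul_right_cancel₀ (pow_ne_zero n hα)
      linear_combination h
    rw [Nat.add_sub_cancel_left, map_inv₀]
    field_simp
    linear_combination -h2

open Polynomial in
theorem eq_monomial_of_twist_eq {k : Type*} [Field k] {σ : RingAut k} {α : k} (hα : α ≠ 0)
    (hrad : ¬ ∃ g : k, g ≠ 0 ∧ ∃ n : ℕ, 1 ≤ n ∧ σ g = α ^ n * g)
    {P : k[X]} {n : ℕ} (h : twist σ α P = C (α ^ n) * P) : P = monomial n (P.coeff n) := by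
  ext i
  rw [coeff_monomial]
  split_ifs with hi
  · rw [hi]
  · by_contra hc
    have hcoeff := congrArg (fun Q : k[X] => Q.coeff i) h
    simp only [coeff_twist, coeff_C_mul] at hcoeff
    exact hi (eq_of_semi_invariant hα hrad hc hcoeff).symm

open Polynomial in
/-- A nonzero `twist`-stable subspace of `k[X]` contains a power of `X`, unless `α` is
a `σ`-radical. -/
theorem exists_X_pow_mem_of_twist_stable {k : Type*} [Field k] {σ : RingAut k} {α : k}
    (hα : α ≠ 0) (hrad : ¬ ∃ g : k, g ≠ 0 ∧ ∃ n : ℕ, 1 ≤ n ∧ σ g = α ^ n * g)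
    (S : Submodule k k[X]) (hS : ∀ P ∈ S, twist σ α P ∈ S) (hne : ∃ P ∈ S, P ≠ 0) :
    ∃ n : ℕ, (X ^ n : k[X]) ∈ S := by
  classical
  have hdeg : ∃ n, ∃ P ∈ S, P ≠ 0 ∧ P.natDegree = n := by
    obtain ⟨P, hP, h0⟩ := hne
    exact ⟨_, P, hP, h0, rfl⟩
  obtain ⟨P, hP, h0, hn⟩ := Nat.find_spec hdeg
  have hmin := fun m => Nat.find_min hdeg (m := m)
  rw [← hn] at hmin
  set n := P.natDegree with hPn
  have hlc : P.coeff n ≠ 0 := by simpa [hPn] using h0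
  set Q : k[X] := (P.coeff n)⁻¹ • P with hQ
  have hQS : Q ∈ S := S.smul_mem _ hP
  have hQn : Q.coeff n = 1 := by simp [hQ, hlc]
  have hQlt : ∀ i, n < i → Q.coeff i = 0 := fun i hi => by
    simp [hQ, coeff_eq_zero_of_natDegree_lt (hPn ▸ hi)]
  have htw : twist σ α Q = C (α ^ n) * Q := by
    rw [← sub_eq_zero]
    by_contra hR
    refine hmin _ ?_ ⟨twist σ α Q - C (α ^ n) * Q, ?_, hR, rfl⟩
    · by_contra hle
      apply hR
      rw [← leadingCoeff_eq_zero, leadingCoeff]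
      rcases (not_lt.mp hle).eq_or_lt with heq | hlt
      · rw [← heq, coeff_sub, coeff_twist, coeff_C_mul, hQn]
        simp
      · rw [coeff_sub, coeff_twist, coeff_C_mul, hQlt _ hlt]
        simp
    · rw [← smul_eq_C_mul]
      exact S.sub_mem (hS Q hQS) (S.smul_mem _ hQS)
  refine ⟨n, ?_⟩
  have hmono := eq_monomial_of_twist_eq hα hrad htw
  rw [hQn, monomial_one_right_eq_X_pow] at hmono
  exact hmono ▸ hQS

/-- Theorem `thm:pisiProp` (i): characterization of Π-monomials. For `t ≠ 0` in a difference
field extension `(K, σK)` of `(k, σ)`, `t` is a Π-monomial over `k` (i.e. `t` is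
transcendental over `k`, `σK(t)/t ∈ k`, and every `σK`-constant of the intermediate field
`k(t)` lies in `Const_σ(k)`) if and only if `σK(t)/t ∈ k` and `σK(t)/t` is not a
`σ`-radical over `k`. -/
theorem pi_monomial_characterization {k K : Type*} [Field k] [CharZero k] [Field K]
    [Algebra k K]
    (σ : RingAut k) (σK : RingAut K)
    (hcompat : ∀ u : k, σK (algebraMap k K u) = algebraMap k K (σ u))
    (t : K) (ht : t ≠ 0) :
    (Transcendental k t ∧
      (∃ α : k, σK t = algebraMap k K α * t) ∧
      (∀ y ∈ IntermediateField.adjoin k {t}, σK y = y →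
        ∃ c : k, σ c = c ∧ algebraMap k K c = y)) ↔
    (∃ α : k, σK t = algebraMap k K α * t ∧
      ¬ ∃ g : k, g ≠ 0 ∧ ∃ n : ℕ, 1 ≤ n ∧ σ g = α ^ n * g) := by
  constructor
  · rintro ⟨htr, ⟨α, hα⟩, hconst⟩
    refine ⟨α, hα, ?_⟩
    rintro ⟨g, hg, n, hn, hσg⟩
    have hgK : algebraMap k K g ≠ 0 := by simpa using hg
    have hα0 : algebraMap k K α ≠ 0 := by
      intro h0
      rw [h0, zero_mul] at hα
      exact ht (by simpa using hα)
    obtain ⟨c, -, hc⟩ := hconst (t ^ n / algebraMap k K g)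
      (div_mem (pow_mem (IntermediateField.mem_adjoin_simple_self k t) n)
        (IntermediateField.algebraMap_mem _ g)) (by
        rw [map_div₀, map_pow, hcompat, hσg, hα, map_mul, map_pow, mul_pow]
        exact mul_div_mul_left _ _ (pow_ne_zero n hα0))
    have htn : t ^ n = algebraMap k K (c * g) := by
      rw [map_mul, hc, div_mul_cancel₀ _ hgK]
    exact htr (IsAlgebraic.of_pow hn (htn ▸ isAlgebraic_algebraMap (c * g)))
  · rintro ⟨α, hα, hrad⟩
    have hα0 : α ≠ 0 := by
      rintro rfl
      rw [map_zero, zero_mul] at hα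
      exact ht (by simpa using hα)
    have haeval := map_aeval_eq_aeval_twist hcompat hα
    have htr : Transcendental k t := by
      rintro ⟨P, hP0, hP⟩
      obtain ⟨n, hn⟩ := exists_X_pow_mem_of_twist_stable hα0 hrad
        (LinearMap.ker (Polynomial.aeval (R := k) t).toLinearMap)
        (fun Q hQ => by
          simp only [LinearMap.mem_ker, AlgHom.toLinearMap_apply] at hQ ⊢
          rw [← haeval, hQ, map_zero])
        ⟨P, by simpa using hP, hP0⟩
      simp only [LinearMap.mem_ker, AlgHom.toLinearMap_apply, map_pow, Polynomial.aeval_X] at hn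
      exact pow_ne_zero n ht hn
    refine ⟨htr, ⟨α, hα⟩, fun y hy hσy => ?_⟩
    obtain ⟨r, s, hrs⟩ := (IntermediateField.mem_adjoin_simple_iff k y).mp hy
    by_cases hs : Polynomial.aeval t s = 0
    · exact ⟨0, map_zero σ, by rw [hrs, hs, div_zero, map_zero]⟩
    obtain ⟨n, P, hP⟩ := exists_X_pow_mem_of_twist_stable hα0 hrad
      ((LinearMap.range (Polynomial.aeval (R := k) t).toLinearMap).comap
        ((LinearMap.mulLeft k y).comp (Polynomial.aeval (R := k) t).toLinearMap))
      (by
        rintro Q ⟨P, hP⟩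
        refine ⟨twist σ α P, ?_⟩
        simp only [AlgHom.toLinearMap_apply, LinearMap.comp_apply,
          LinearMap.mulLeft_apply] at hP ⊢
        rw [← haeval, ← haeval, hP, map_mul, hσy])
      ⟨s, ⟨r, by simp [hrs, hs]⟩, by rintro rfl; simp at hs⟩
    simp only [AlgHom.toLinearMap_apply, LinearMap.comp_apply, LinearMap.mulLeft_apply,
      map_pow, Polynomial.aeval_X] at hP
    have htw : twist σ α P = Polynomial.C (α ^ n) * P := by
      apply transcendental_iff_injective.mp htr
      rw [← haeval, map_mul, hP, map_mul, hσy, map_pow, hα, Polynomial.aeval_C, map_pow]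
      ring
    rw [eq_monomial_of_twist_eq hα0 hrad htw, Polynomial.aeval_monomial] at hP
    have hy : algebraMap k K (P.coeff n) = y := mul_right_cancel₀ (pow_ne_zero n ht) hP
    refine ⟨P.coeff n, (algebraMap k K).injective ?_, hy⟩
    rw [← hcompat, hy, hσy]
end

section
/- Let (k, σ) be a difference field, K a field extension of k, σ_K a field automorphism of K with σ_K(u) = σ(u) for all u ∈ k, and t ∈ K nonzero. Then the following are equivalent: (a) t is a Σ*-monomial over k, i.e., t is transcendental over k, σ_K(t) − t ∈ k, and every element y of the intermediate field k(t) ⊆ K with σ_K(y) = y lies in Const_σ(k); (b) σ_K(t) − t ∈ k and there is no w ∈ k with σ(w) − w = σ_K(t) − t. -/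
open Finset

open Polynomial in
/-- The action `∑ aᵢ Xⁱ ↦ ∑ σ(aᵢ) (X + β)ⁱ` on polynomials extending `σ` by `X ↦ X + β`. -/
noncomputable def shiftMap {k : Type*} [Field k] (σ : RingAut k) (β : k) (p : k[X]) : k[X] :=
  Polynomial.taylor β (p.map (σ : k →+* k))

namespace shiftMap

open Polynomial

variable {k : Type*} [Field k] (σ : RingAut k) (β : k)

theorem natDegree_eq (p : k[X]) : (shiftMap σ β p).natDegree = p.natDegree := by
  simp [shiftMap, natDegree_taylor, natDegree_map]

theorem monic {p : k[X]} (hp : p.Monic) : (shiftMap σ β p).Monic :=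
  by
  rw [Monic, shiftMap, leadingCoeff_taylor]
  exact hp.map _

theorem aeval_eq {K : Type*} [Field K] [Algebra k K] {σK : RingAut K}
    (hcompat : ∀ u : k, σK (algebraMap k K u) = algebraMap k K (σ u))
    {t : K} (hβ : σK t - t = algebraMap k K β) (p : k[X]) :
    aeval t (shiftMap σ β p) = σK (aeval t p) := by
  have ht : aeval t (X + C β) = σK t := by
    rw [map_add, aeval_X, aeval_C, ← hβ]; ring
  rw [shiftMap, taylor_apply, aeval_comp, ht]
  induction p using Polynomial.induction_on' with
  | add p q hp hq => simp only [Polynomial.map_add, map_add, hp, hq]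
  | monomial n a => simp [aeval_monomial, hcompat]

/-- A nonconstant fixed polynomial yields a solution of the telescoping equation. -/
theorem exists_sub_eq_of_fixed [CharZero k] {p : k[X]} (hp : p.natDegree ≠ 0)
    (hfix : shiftMap σ β p = p) : ∃ w : k, σ w - w = β := by
  obtain ⟨n, hn⟩ := Nat.exists_eq_succ_of_ne_zero hp
  have hl : σ (p.coeff (n + 1)) = p.coeff (n + 1) := by
    have h := congrArg leadingCoeff hfix
    rw [shiftMap, leadingCoeff_taylor, leadingCoeff_map, leadingCoeff, hn] at h
    exact h
  have hl0 : p.coeff (n + 1) ≠ 0 := by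
    have : p ≠ 0 := by rintro rfl; simp at hp
    rw [← Nat.succ_eq_add_one, ← hn]
    exact leadingCoeff_ne_zero.2 this
  have hd : (hasseDeriv n (p.map (σ : k →+* k))).natDegree < 2 := by
    have := natDegree_hasseDeriv_le (p.map (σ : k →+* k)) n
    rw [natDegree_map] at this
    omega
  have ha : σ (p.coeff n) + (n + 1) * p.coeff (n + 1) * β = p.coeff n := by
    have h := congrArg (fun q => coeff q n) hfix
    simp only [shiftMap, taylor_coeff] at h
    rw [eval_eq_sum_range' hd] at h
    simp only [Finset.sum_range_succ, Finset.sum_range_zero, hasseDeriv_coeff, coeff_map] at h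
    simp only [zero_add, Nat.choose_self, Nat.cast_one, one_mul, pow_zero, mul_one, pow_one,
      add_comm 1 n, Nat.choose_succ_self_right, RingHom.coe_coe, Nat.cast_add] at h
    rwa [hl] at h
  have hn0 : (n + 1 : k) ≠ 0 := Nat.cast_add_one_ne_zero n
  refine ⟨-p.coeff n / ((n + 1) * p.coeff (n + 1)), ?_⟩
  rw [map_div₀, map_mul, map_neg, hl, map_add, map_natCast, map_one]
  field_simp
  linear_combination -ha

end shiftMap

section

open Polynomial

variable {k K : Type*} [Field k] [Field K] [Algebra k K]

theorem transcendental_of_forall_sub_ne [CharZero k] {σ : RingAut k} {σK : RingAut K}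
    (hcompat : ∀ u : k, σK (algebraMap k K u) = algebraMap k K (σ u))
    {t : K} {β : k} (hβ : σK t - t = algebraMap k K β) (hw : ¬ ∃ w : k, σ w - w = β) :
    Transcendental k t := by
  intro halg
  have hint : IsIntegral k t := halg.isIntegral
  refine hw (shiftMap.exists_sub_eq_of_fixed σ β (minpoly.natDegree_pos hint).ne' ?_)
  have hdvd : minpoly k t ∣ shiftMap σ β (minpoly k t) := minpoly.dvd k t <| by
    rw [shiftMap.aeval_eq σ β hcompat hβ, minpoly.aeval, map_zero]
  exact eq_of_monic_of_dvd_of_natDegree_le (minpoly.monic hint)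
    (shiftMap.monic σ β (minpoly.monic hint)) hdvd (shiftMap.natDegree_eq σ β _).le

theorem exists_isCoprime_monic_of_mem_adjoin_simple {t y : K}
    (hy : y ∈ IntermediateField.adjoin k {t}) :
    ∃ p q : k[X], IsCoprime p q ∧ q.Monic ∧ y * aeval t q = aeval t p := by
  classical
  obtain ⟨r, s, rfl⟩ := (IntermediateField.mem_adjoin_simple_iff k y).1 hy
  by_cases hs : aeval t s = 0
  · exact ⟨0, 1, isCoprime_one_right, monic_one, by simp [hs]⟩
  have hs0 : s ≠ 0 := by rintro rfl; simp at hs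
  obtain ⟨a, hr⟩ := EuclideanDomain.gcd_dvd_left r s
  obtain ⟨b, hb⟩ := EuclideanDomain.gcd_dvd_right r s
  set g := EuclideanDomain.gcd r s with hg
  have hg0 : g ≠ 0 := by rintro h; rw [h, zero_mul] at hb; exact hs0 hb
  have hb0 : b ≠ 0 := by rintro rfl; rw [mul_zero] at hb; exact hs0 hb
  have hcop : IsCoprime a b := by
    refine ⟨EuclideanDomain.gcdA r s, EuclideanDomain.gcdB r s, mul_left_cancel₀ hg0 ?_⟩
    have h := EuclideanDomain.gcd_eq_gcd_ab r s
    rw [← hg] at h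
    linear_combination -h - EuclideanDomain.gcdA r s * hr - EuclideanDomain.gcdB r s * hb
  have hu : IsUnit (C b.leadingCoeff⁻¹) :=
    isUnit_C.2 (inv_ne_zero (leadingCoeff_ne_zero.2 hb0)).isUnit
  refine ⟨a * C b.leadingCoeff⁻¹, b * C b.leadingCoeff⁻¹, ?_,
    monic_mul_leadingCoeff_inv hb0, ?_⟩
  · exact (isCoprime_mul_unit_right hu a b).2 hcop
  · rw [hb, map_mul] at hs
    have hgt := left_ne_zero_of_mul hs
    have hst := right_ne_zero_of_mul hs
    rw [hr, hb]
    simp only [map_mul]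
    field_simp

theorem exists_const_of_fixed_of_mem_adjoin [CharZero k] {σ : RingAut k} {σK : RingAut K}
    (hcompat : ∀ u : k, σK (algebraMap k K u) = algebraMap k K (σ u))
    {t : K} {β : k} (hβ : σK t - t = algebraMap k K β) (hw : ¬ ∃ w : k, σ w - w = β)
    {y : K} (hy : y ∈ IntermediateField.adjoin k {t}) (hfix : σK y = y) :
    ∃ c : k, σ c = c ∧ algebraMap k K c = y := by
  have hinj := transcendental_iff_injective.1 (transcendental_of_forall_sub_ne hcompat hβ hw)
  have hS := shiftMap.aeval_eq σ β hcompat hβ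
  have hconst : ∀ p : k[X], shiftMap σ β p = p → p.natDegree = 0 := fun p hp =>
    by_contra fun h => hw (shiftMap.exists_sub_eq_of_fixed σ β h hp)
  obtain ⟨p, q, hcop, hq, hpq⟩ := exists_isCoprime_monic_of_mem_adjoin_simple hy
  have hSpq : y * aeval t (shiftMap σ β q) = aeval t (shiftMap σ β p) := by
    rw [hS, hS, ← hpq, map_mul, hfix]
  have hcross : p * shiftMap σ β q = q * shiftMap σ β p := hinj <| by
    rw [map_mul, map_mul, ← hpq, ← hSpq]; ring
  have hdvd : q ∣ shiftMap σ β q := hcop.symm.dvd_of_dvd_mul_left ⟨_, hcross⟩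
  have hq1 : q = 1 := hq.natDegree_eq_zero.1 <| hconst q <|
    eq_of_monic_of_dvd_of_natDegree_le hq (shiftMap.monic σ β hq) hdvd
      (shiftMap.natDegree_eq σ β q).le
  rw [hq1, map_one, mul_one] at hpq
  have hp : shiftMap σ β p = p := hinj <| by rw [hS, ← hpq, hfix]
  obtain ⟨c, rfl⟩ := natDegree_eq_zero.1 (hconst p hp)
  rw [aeval_C] at hpq
  refine ⟨c, (algebraMap k K).injective ?_, hpq.symm⟩
  rw [← hcompat, ← hpq, hfix]

end

/-- Theorem `thm:pisiProp` (ii): characterization of Σ*-monomials. For `t ≠ 0` in a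
difference field extension `(K, σK)` of `(k, σ)`, `t` is a Σ*-monomial over `k` (i.e. `t`
is transcendental over `k`, `σK(t) - t ∈ k`, and every `σK`-constant of the intermediate
field `k(t)` lies in `Const_σ(k)`) if and only if `σK(t) - t ∈ k` and there is no `w ∈ k`
with `σ(w) - w = σK(t) - t`. -/
theorem sigma_monomial_characterization {k K : Type*} [Field k] [CharZero k] [Field K]
    [Algebra k K]
    (σ : RingAut k) (σK : RingAut K)
    (hcompat : ∀ u : k, σK (algebraMap k K u) = algebraMap k K (σ u))
    (t : K) (ht : t ≠ 0) :
    (Transcendental k t ∧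
      (∃ β : k, σK t - t = algebraMap k K β) ∧
      (∀ y ∈ IntermediateField.adjoin k {t}, σK y = y →
        ∃ c : k, σ c = c ∧ algebraMap k K c = y)) ↔
    (∃ β : k, σK t - t = algebraMap k K β ∧ ¬ ∃ w : k, σ w - w = β) := by
  constructor
  · rintro ⟨htr, ⟨β, hβ⟩, hconst⟩
    refine ⟨β, hβ, ?_⟩
    rintro ⟨w, rfl⟩
    obtain ⟨c, -, hc⟩ := hconst (t - algebraMap k K w)
      (sub_mem (IntermediateField.mem_adjoin_simple_self k t)
        (IntermediateField.algebraMap_mem _ w))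
      (by rw [map_sub, hcompat]; rw [map_sub] at hβ; linear_combination hβ)
    refine htr ?_
    rw [← sub_add_cancel t (algebraMap k K w), ← hc, ← map_add]
    exact isAlgebraic_algebraMap _
  · rintro ⟨β, hβ, hw⟩
    exact ⟨transcendental_of_forall_sub_ne hcompat hβ hw, ⟨β, hβ⟩,
      fun y hy hfix => exists_const_of_fixed_of_mem_adjoin hcompat hβ hw hy hfix⟩
end

section
/- Let (k, σ) be a difference field, α ∈ k*, β ∈ k with either β = 0 (Π case) or α = 1 (Σ* case), and let K = k(t) be the rational function field over k with a field automorphism σ_K satisfying σ_K(u) = σ(u) for u ∈ k and σ_K(t) = α·t + β; let σ' denote its restriction to k[t]. Assume t is a ΠΣ*-monomial over k, i.e., every y ∈ K with σ_K(y) = y lies in Const_σ(k) (embedded in K). Then for every nonzero r ∈ K there exist nonzero polynomials a, b, c ∈ k[t] such that: r = (a/b)·(σ'(c)/c); spr_{σ'}(a, b) = ∅; gcd(a, c) = 1; gcd(b, σ'(c)) = 1; spr_{σ'}(c, c) is finite; and, in the Π case (β = 0), the constant coefficient of c is nonzero. -/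
open Finset Polynomial

section SkewAut

variable {k : Type*} [Field k] {σ : RingAut k} {α β : k} {τ : RingAut k[X]}

/-- An automorphism of `k[X]` that acts by `σ` on `k` and sends `X` to `αX + β` is coefficientwise
application of `σ` followed by an affine substitution. -/
theorem polyAut_apply (hC : ∀ u : k, τ (C u) = C (σ u)) (hX : τ X = C α * X + C β) (p : k[X]) :
    τ p = (p.map (σ : k →+* k)).comp (C α * X + C β) := by
  have h : (τ : k[X] →+* k[X]) =
      (compRingHom (C α * X + C β)).comp (mapRingHom (σ : k →+* k)) := by
    apply Polynomial.ringHom_ext <;> simp [hC, hX]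
  exact congrArg (fun f : k[X] →+* k[X] => f p) h

theorem natDegree_polyAut (hα : α ≠ 0) (hC : ∀ u : k, τ (C u) = C (σ u))
    (hX : τ X = C α * X + C β) (p : k[X]) : (τ p).natDegree = p.natDegree := by
  rw [polyAut_apply hC hX, natDegree_comp, natDegree_linear hα, mul_one,
    natDegree_map_eq_of_injective (RingEquiv.injective σ)]

theorem leadingCoeff_polyAut (hα : α ≠ 0) (hC : ∀ u : k, τ (C u) = C (σ u))
    (hX : τ X = C α * X + C β) (p : k[X]) :
    (τ p).leadingCoeff = σ p.leadingCoeff * α ^ p.natDegree := by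
  rw [polyAut_apply hC hX, leadingCoeff_comp (by rw [natDegree_linear hα]; exact one_ne_zero),
    leadingCoeff_linear hα, leadingCoeff_map_of_injective (RingEquiv.injective σ),
    natDegree_map_eq_of_injective (RingEquiv.injective σ)]
  rfl

theorem X_dvd_polyAut (hα : α ≠ 0) (hX : τ X = C α * X) {p : k[X]} (h : X ∣ τ p) : X ∣ p := by
  have hu : Associated (τ X) X := by
    rw [hX]
    exact associated_unit_mul_left X _ (isUnit_C.2 hα.isUnit)
  exact (map_dvd_iff τ).1 (hu.dvd.trans h)

theorem X_dvd_polyAut_pow (hα : α ≠ 0) (hX : τ X = C α * X) {p : k[X]} (m : ℕ)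
    (h : X ∣ (τ ^ m) p) : X ∣ p := by
  induction m with
  | zero => simpa using h
  | succ m ih =>
    rw [pow_succ'] at h
    exact ih (X_dvd_polyAut hα hX h)

/-- The orbit product `∏_{i<m} τ^i p` telescopes. -/
theorem polyAut_orbit_prod (τ : RingAut k[X]) (p : k[X]) (m : ℕ) :
    τ (∏ i ∈ range m, (τ ^ i) p) * p = (∏ i ∈ range m, (τ ^ i) p) * (τ ^ m) p := by
  rw [← Finset.prod_range_succ, Finset.prod_range_succ', map_prod]
  simp [pow_succ']

/-- Over a ΠΣ*-monomial, the only irreducible polynomial that is periodic up to units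
is the monomial itself, in the Π case. -/
theorem X_dvd_of_associated_polyAut_pow (hα : α ≠ 0) (hcase : β = 0 ∨ α = 1)
    (hC : ∀ u : k, τ (C u) = C (σ u)) (hX : τ X = C α * X + C β)
    {σK : RingAut (RatFunc k)}
    (hcompat : ∀ p : k[X], σK (algebraMap k[X] (RatFunc k) p) = algebraMap k[X] (RatFunc k) (τ p))
    (hconst : ∀ y : RatFunc k, σK y = y → ∃ c : k, σ c = c ∧ algebraMap k (RatFunc k) c = y)
    {p : k[X]} (hp : Irreducible p) {m : ℕ} (hm : m ≠ 0) (h : Associated p ((τ ^ m) p)) :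
    β = 0 ∧ X ∣ p := by
  have hs : ∃ s : k[X], s ≠ 0 ∧ τ s = C α * s ∧ (p ∣ s → β = 0 ∧ X ∣ p) := by
    rcases hcase with rfl | rfl
    · exact ⟨X, X_ne_zero, by simpa using hX,
        fun h => ⟨rfl, ((hp.dvd_irreducible_iff_associated irreducible_X).1 h).symm.dvd⟩⟩
    · exact ⟨1, one_ne_zero, by simp, fun h => (hp.not_dvd_one h).elim⟩
  obtain ⟨s, hs0, hτs, hps⟩ := hs
  set q : k[X] := ∏ i ∈ range m, (τ ^ i) p
  have hpq : p ∣ q := by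
    have h0 : (τ ^ 0) p ∣ q := Finset.dvd_prod_of_mem (fun i => (τ ^ i) p)
      (Finset.mem_range.2 (Nat.pos_of_ne_zero hm))
    rwa [pow_zero, RingAut.one_apply] at h0
  have hq0 : q ≠ 0 := Finset.prod_ne_zero_iff.2 fun i _ =>
    (map_ne_zero_iff _ (τ ^ i).injective).2 hp.ne_zero
  obtain ⟨u, hu⟩ := h
  obtain ⟨v, -, hv⟩ := isUnit_iff.1 u.isUnit
  have hτq : τ q = C v * q := by
    apply mul_right_cancel₀ hp.ne_zero
    rw [polyAut_orbit_prod, ← hu, ← hv]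
    ring
  set d := q.natDegree
  set l := q.leadingCoeff
  have hl : l ≠ 0 := leadingCoeff_ne_zero.2 hq0
  have hlc : σ l * α ^ d = v * l := by
    rw [← leadingCoeff_polyAut hα hC hX, hτq, leadingCoeff_mul, leadingCoeff_C]
  have hσl : σ l ≠ 0 := by simpa using hl
  let A := algebraMap k[X] (RatFunc k)
  have hA : Function.Injective A := RatFunc.algebraMap_injective k
  have hne {f : k[X]} (hf : f ≠ 0) : A f ≠ 0 := (map_ne_zero_iff A hA).2 hf
  have hfix : σK (A q / A (C l * s ^ d)) = A q / A (C l * s ^ d) := by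
    rw [map_div₀, hcompat, hcompat, div_eq_div_iff, ← map_mul, ← map_mul]
    · congr 1
      rw [hτq, map_mul, map_pow, hC, hτs, mul_pow]
      have : C (σ l) * C α ^ d = C v * C l := by rw [← C_pow, ← C_mul, ← C_mul, hlc]
      linear_combination (-(q * s ^ d)) * this
    · exact hne ((map_ne_zero_iff τ τ.injective).2
        (mul_ne_zero (C_ne_zero.2 hl) (pow_ne_zero _ hs0)))
    · exact hne (mul_ne_zero (C_ne_zero.2 hl) (pow_ne_zero _ hs0))
  obtain ⟨c, -, hc⟩ := hconst _ hfix
  rw [eq_div_iff (hne (mul_ne_zero (C_ne_zero.2 hl) (pow_ne_zero _ hs0))),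
    IsScalarTower.algebraMap_apply k k[X] (RatFunc k), ← map_mul] at hc
  have hqs : C (c * l) * s ^ d = q := by
    rw [C_mul, mul_assoc]
    exact hA hc
  have hcl : c * l ≠ 0 := by
    rintro h0
    rw [h0, C_0, zero_mul] at hqs
    exact hq0 hqs.symm
  rw [← hqs] at hpq
  exact hps (hp.prime.dvd_of_dvd_pow
    (((isUnit_C.2 hcl.isUnit).dvd_mul_left).1 hpq))

/-- The spread of a polynomial without periodic irreducible factors is finite. -/
theorem finite_spread_self (τ : RingAut k[X]) {c : k[X]} (hc : c ≠ 0)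
    (h : ∀ p : k[X], Irreducible p → p ∣ c → ∀ m : ℕ, m ≠ 0 → ¬ Associated p ((τ ^ m) p)) :
    Set.Finite {m : ℕ | ¬ IsCoprime c ((τ ^ m) c)} := by
  classical
  let F := (UniqueFactorizationMonoid.normalizedFactors c).toFinset
  have hF : ∀ p, Irreducible p → p ∣ c → ∃ q ∈ F, Associated p q := fun p hp hpc => by
    obtain ⟨q, hq, hpq⟩ :=
      UniqueFactorizationMonoid.exists_mem_normalizedFactors_of_dvd hc hp hpc
    exact ⟨q, Multiset.mem_toFinset.2 hq, hpq⟩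
  have hfin : Set.Finite (⋃ x ∈ F ×ˢ F, {m : ℕ | Associated x.1 ((τ ^ m) x.2)}) := by
    refine Set.Finite.biUnion (Finset.finite_toSet _) fun x hx => Set.Subsingleton.finite ?_
    have hx2 : x.2 ∈ UniqueFactorizationMonoid.normalizedFactors c :=
      Multiset.mem_toFinset.1 (Finset.mem_product.1 hx).2
    have hlt : ∀ m n : ℕ, m < n → Associated x.1 ((τ ^ m) x.2) →
        ¬ Associated x.1 ((τ ^ n) x.2) := fun m n hmn h1 h2 => by
      refine h x.2 (UniqueFactorizationMonoid.irreducible_of_normalized_factor _ hx2)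
        (UniqueFactorizationMonoid.dvd_of_mem_normalizedFactors hx2) (n - m)
        (Nat.sub_ne_zero_of_lt hmn) ?_
      have h3 := h1.symm.trans h2
      rw [← Nat.add_sub_cancel' hmn.le, pow_add] at h3
      simpa only [RingAut.mul_apply, RingEquiv.symm_apply_apply] using h3.map (τ ^ m).symm
    intro m hm n hn
    rcases lt_trichotomy m n with hmn | hmn | hmn
    · exact (hlt m n hmn hm hn).elim
    · exact hmn
    · exact (hlt n m hmn hn hm).elim
  refine hfin.subset fun m hm => ?_
  by_contra hnot
  refine hm (isCoprime_of_irreducible_dvd (fun h0 => hc h0.1) fun p hp hpc hpm => hnot ?_)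
  obtain ⟨p', rfl⟩ := (τ ^ m).surjective p
  have hp' : Irreducible p' := (MulEquiv.irreducible_iff (τ ^ m)).1 hp
  obtain ⟨q, hq, hpq⟩ := hF _ hp hpc
  obtain ⟨q', hq', hpq'⟩ := hF p' hp' ((map_dvd_iff (τ ^ m)).1 hpm)
  exact Set.mem_biUnion (x := (q, q')) (Finset.mem_product.2 ⟨hq, hq'⟩)
    (hpq.symm.trans (hpq'.map (τ ^ m)))

/-- `a, b, c` represent the fraction `n / d` as `(a / b) * (τ c / c)`; under the condition `P`
the polynomial `c` is moreover not divisible by `X`. -/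
structure IsShiftRepr (P : Prop) (τ : RingAut k[X]) (n d a b c : k[X]) : Prop where
  left_ne_zero : a ≠ 0
  right_ne_zero : b ≠ 0
  shift_ne_zero : c ≠ 0
  eq : n * b * c = d * a * τ c
  not_X_dvd : P → ¬ X ∣ c

namespace IsShiftRepr

variable {P : Prop} {n d a b c p : k[X]}

theorem cancel (h : IsShiftRepr P τ n d (p * a) (p * b) c) : IsShiftRepr P τ n d a b c where
  left_ne_zero := right_ne_zero_of_mul h.left_ne_zero
  right_ne_zero := right_ne_zero_of_mul h.right_ne_zero
  shift_ne_zero := h.shift_ne_zero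
  eq := mul_left_cancel₀ (left_ne_zero_of_mul h.left_ne_zero) (by linear_combination h.eq)
  not_X_dvd := h.not_X_dvd

theorem cancel_shift (hτ : P → ∀ m : ℕ, ∀ f : k[X], X ∣ (τ ^ m) f → X ∣ f) {m : ℕ}
    (hp : P → ¬ X ∣ p) (h : IsShiftRepr P τ n d ((τ ^ m) p * a) (p * b) c) :
    IsShiftRepr P τ n d a b (c * ∏ i ∈ range m, (τ ^ i) p) where
  left_ne_zero := right_ne_zero_of_mul h.left_ne_zero
  right_ne_zero := right_ne_zero_of_mul h.right_ne_zero
  shift_ne_zero := mul_ne_zero h.shift_ne_zero <| Finset.prod_ne_zero_iff.2 fun i _ =>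
    (map_ne_zero_iff _ (τ ^ i).injective).2 (left_ne_zero_of_mul h.right_ne_zero)
  eq := by
    apply mul_left_cancel₀ (left_ne_zero_of_mul h.right_ne_zero)
    rw [map_mul]
    linear_combination (∏ i ∈ range m, (τ ^ i) p) * h.eq -
      d * a * τ c * polyAut_orbit_prod τ p m
  not_X_dvd hP hX := by
    rcases prime_X.dvd_or_dvd hX with hX | hX
    · exact h.not_X_dvd hP hX
    · obtain ⟨i, -, hi⟩ := (prime_X.dvd_finsetProd_iff _).1 hX
      exact hp hP (hτ hP i p hi)

theorem absorb_left (h : IsShiftRepr P τ n d (p * a) b (p * c)) :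
    IsShiftRepr P τ n d (τ p * a) b c where
  left_ne_zero := mul_ne_zero (by simpa using left_ne_zero_of_mul h.left_ne_zero)
    (right_ne_zero_of_mul h.left_ne_zero)
  right_ne_zero := h.right_ne_zero
  shift_ne_zero := right_ne_zero_of_mul h.shift_ne_zero
  eq := mul_left_cancel₀ (left_ne_zero_of_mul h.left_ne_zero) (by
    have := h.eq
    rw [map_mul] at this
    linear_combination this)
  not_X_dvd hP hX := h.not_X_dvd hP (hX.mul_left _)

theorem absorb_right (h : IsShiftRepr P τ n d a (τ p * b) (p * c)) :
    IsShiftRepr P τ n d a (p * b) c where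
  left_ne_zero := h.left_ne_zero
  right_ne_zero := mul_ne_zero (left_ne_zero_of_mul h.shift_ne_zero)
    (right_ne_zero_of_mul h.right_ne_zero)
  shift_ne_zero := right_ne_zero_of_mul h.shift_ne_zero
  eq := mul_left_cancel₀ (left_ne_zero_of_mul h.right_ne_zero) (by
    have := h.eq
    rw [map_mul] at this
    linear_combination this)
  not_X_dvd hP hX := h.not_X_dvd hP (hX.mul_left _)

/-- If a representation exists, then there is one satisfying the coprimality conditions: each
violation allows a reduction of the degree of `a * b`, or of that of `c` alone. -/
theorem exists_coprime {a b c : k[X]} (hdeg : ∀ f : k[X], (τ f).natDegree = f.natDegree)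
    (hτ : P → ∀ m : ℕ, ∀ f : k[X], X ∣ (τ ^ m) f → X ∣ f)
    (hτX : P → ∀ m : ℕ, X ∣ (τ ^ m) X) (h : IsShiftRepr P τ n d a b c) :
    ∃ a b c : k[X], IsShiftRepr P τ n d a b c ∧ (∀ m : ℕ, IsCoprime a ((τ ^ m) b)) ∧
      IsCoprime a c ∧ IsCoprime b (τ c) := by
  by_cases h1 : ∀ m : ℕ, IsCoprime a ((τ ^ m) b)
  · by_cases h2 : IsCoprime a c
    · by_cases h3 : IsCoprime b (τ c)
      · exact ⟨a, b, c, h, h1, h2, h3⟩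
      · obtain ⟨q, hq, hqb, hqc⟩ : ∃ q, Irreducible q ∧ q ∣ b ∧ q ∣ τ c := by
          by_contra! hno
          exact h3 (isCoprime_of_irreducible_dvd (fun h0 => h.right_ne_zero h0.1) hno)
        obtain ⟨p, rfl⟩ := τ.surjective q
        obtain ⟨b, rfl⟩ := hqb
        obtain ⟨c, rfl⟩ := (map_dvd_iff τ).1 hqc
        have hp : 0 < p.natDegree := hdeg p ▸ hq.natDegree_pos
        have h' := h.absorb_right
        have e1 := natDegree_mul (left_ne_zero_of_mul h.shift_ne_zero) h'.shift_ne_zero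
        have e2 := natDegree_mul (left_ne_zero_of_mul h'.right_ne_zero)
          (right_ne_zero_of_mul h'.right_ne_zero)
        have e3 := natDegree_mul (left_ne_zero_of_mul h.right_ne_zero)
          (right_ne_zero_of_mul h.right_ne_zero)
        have e4 := hdeg p
        exact exists_coprime hdeg hτ hτX h'
    · obtain ⟨p, hp, hpa, hpc⟩ : ∃ q, Irreducible q ∧ q ∣ a ∧ q ∣ c := by
        by_contra! hno
        exact h2 (isCoprime_of_irreducible_dvd (fun h0 => h.left_ne_zero h0.1) hno)
      obtain ⟨a, rfl⟩ := hpa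
      obtain ⟨c, rfl⟩ := hpc
      have hp := hp.natDegree_pos
      have h' := h.absorb_left
      have e1 := natDegree_mul (left_ne_zero_of_mul h.shift_ne_zero) h'.shift_ne_zero
      have e2 := natDegree_mul (left_ne_zero_of_mul h'.left_ne_zero)
        (right_ne_zero_of_mul h'.left_ne_zero)
      have e3 := natDegree_mul (left_ne_zero_of_mul h.left_ne_zero)
        (right_ne_zero_of_mul h.left_ne_zero)
      have e4 := hdeg p
      exact exists_coprime hdeg hτ hτX h'
  · push Not at h1
    obtain ⟨m, hm⟩ := h1
    obtain ⟨q, hq, hqa, hqb⟩ : ∃ q, Irreducible q ∧ q ∣ a ∧ q ∣ (τ ^ m) b := by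
      by_contra! hno
      exact hm (isCoprime_of_irreducible_dvd (fun h0 => h.left_ne_zero h0.1) hno)
    obtain ⟨p, rfl⟩ := (τ ^ m).surjective q
    have hpb := (map_dvd_iff (τ ^ m)).1 hqb
    by_cases hpX : P ∧ X ∣ p
    · obtain ⟨a, rfl⟩ : X ∣ a :=
        (hτX hpX.1 m).trans (((map_dvd_iff (τ ^ m)).2 hpX.2).trans hqa)
      obtain ⟨b, rfl⟩ := hpX.2.trans hpb
      have h' := h.cancel
      have e1 := natDegree_mul (X_ne_zero (R := k)) h'.left_ne_zero
      have e2 := natDegree_mul (X_ne_zero (R := k)) h'.right_ne_zero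
      have e3 := natDegree_X (R := k)
      exact exists_coprime hdeg hτ hτX h'
    · obtain ⟨a, rfl⟩ := hqa
      obtain ⟨b, rfl⟩ := hpb
      have h' := h.cancel_shift hτ (fun hP hX => hpX ⟨hP, hX⟩)
      have e1 := natDegree_mul (left_ne_zero_of_mul h.left_ne_zero) h'.left_ne_zero
      have e2 := natDegree_mul (left_ne_zero_of_mul h.right_ne_zero) h'.right_ne_zero
      have e3 := hq.natDegree_pos
      exact exists_coprime hdeg hτ hτX h'
termination_by (a.natDegree + b.natDegree, c.natDegree)
decreasing_by all_goals (subst_vars; simp only [Prod.lex_def]; omega)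

end IsShiftRepr

end SkewAut

/-- Corollary `Cor:NormalFormPiSi`: normal form of rational functions over a ΠΣ*-monomial.
The ΠΣ*-extension `k(t)` is modeled by `RatFunc k` with automorphism `σK` extending the
automorphism `σ'` of `k[t]` given by `σ'(u) = σ(u)` for `u ∈ k` and `σ'(t) = α·t + β`,
where `β = 0` (Π case) or `α = 1` (Σ* case), and where the constants of `k(t)` coincide
with the constants of `k`. Every nonzero `r ∈ k(t)` admits a decomposition
`r = (a/b)·(σ'(c)/c)` with empty spread of `(a,b)`, coprimality conditions, finite spread
of `c`, and `c(0) ≠ 0` in the Π case. -/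
theorem normal_form_pisi_monomial {k : Type*} [Field k] [CharZero k]
    (σ : RingAut k) (α β : k) (hα : α ≠ 0) (hcase : β = 0 ∨ α = 1)
    (σ' : RingAut (Polynomial k))
    (hσ'C : ∀ u : k, σ' (Polynomial.C u) = Polynomial.C (σ u))
    (hσ'X : σ' Polynomial.X = Polynomial.C α * Polynomial.X + Polynomial.C β)
    (σK : RingAut (RatFunc k))
    (hcompat : ∀ p : Polynomial k,
      σK (algebraMap (Polynomial k) (RatFunc k) p) = algebraMap (Polynomial k) (RatFunc k) (σ' p))
    (hconst : ∀ y : RatFunc k, σK y = y → ∃ c : k, σ c = c ∧ algebraMap k (RatFunc k) c = y)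
    (r : RatFunc k) (hr : r ≠ 0) :
    ∃ a b c : Polynomial k, a ≠ 0 ∧ b ≠ 0 ∧ c ≠ 0 ∧
      r * algebraMap (Polynomial k) (RatFunc k) b * algebraMap (Polynomial k) (RatFunc k) c
        = algebraMap (Polynomial k) (RatFunc k) a * algebraMap (Polynomial k) (RatFunc k) (σ' c) ∧
      {m : ℕ | ¬ IsCoprime a ((σ' ^ m) b)} = ∅ ∧
      IsCoprime a c ∧
      IsCoprime b (σ' c) ∧
      Set.Finite {m : ℕ | ¬ IsCoprime c ((σ' ^ m) c)} ∧
      (β = 0 → c.coeff 0 ≠ 0) := by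
  have hpow : β = 0 → ∀ m : ℕ, ∀ f : k[X], X ∣ (σ' ^ m) f → X ∣ f := fun hβ m f =>
    X_dvd_polyAut_pow hα (by simpa [hβ] using hσ'X) m
  have hpowX : β = 0 → ∀ m : ℕ, X ∣ (σ' ^ m) X := fun hβ m => by
    induction m with
    | zero => simp
    | succ m ih =>
      rw [pow_succ, RingAut.mul_apply, hσ'X, hβ, C_0, add_zero, map_mul]
      exact ih.mul_left _
  have h0 : IsShiftRepr (β = 0) σ' r.num r.denom r.num r.denom 1 :=
    ⟨RatFunc.num_ne_zero hr, r.denom_ne_zero, one_ne_zero, by rw [map_one]; ring,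
      fun _ => prime_X.not_dvd_one⟩
  obtain ⟨a, b, c, h, h1, h2, h3⟩ :=
    h0.exists_coprime (natDegree_polyAut hα hσ'C hσ'X) hpow hpowX
  refine ⟨a, b, c, h.left_ne_zero, h.right_ne_zero, h.shift_ne_zero, ?_, ?_, h2, h3, ?_, ?_⟩
  · have hd : algebraMap k[X] (RatFunc k) r.denom ≠ 0 :=
      (map_ne_zero_iff _ (RatFunc.algebraMap_injective k)).2 r.denom_ne_zero
    have hnum : r * algebraMap k[X] (RatFunc k) r.denom = algebraMap k[X] (RatFunc k) r.num :=
      ((div_eq_iff hd).1 r.num_div_denom).symm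
    have he := congrArg (algebraMap k[X] (RatFunc k)) h.eq
    simp only [map_mul] at he
    apply mul_left_cancel₀ hd
    linear_combination he +
      algebraMap k[X] (RatFunc k) b * algebraMap k[X] (RatFunc k) c * hnum
  · exact Set.eq_empty_iff_forall_notMem.2 fun m hm => hm (h1 m)
  · refine finite_spread_self σ' h.shift_ne_zero fun p hp hpc m hm hass => ?_
    obtain ⟨hβ, hXp⟩ :=
      X_dvd_of_associated_polyAut_pow hα hcase hσ'C hσ'X hcompat hconst hp hm hass
    exact h.not_X_dvd hβ (hXp.trans hpc)
  · exact fun hβ hc => h.not_X_dvd hβ (X_dvd_iff.2 hc)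
end

section
/- Let (k, σ) be a difference field and let u, v ∈ k be nonzero. If u is not a σ-radical over k, then the set Γ(u, v; k) := {γ ∈ ℤ : there exists w ∈ k* with u^γ = v·σ(w)/w} has at most one element. -/
/-- Lemma `Lemma:Uniqueness`: if `u` is not a `σ`-radical over the difference field
`(k, σ)`, then `Γ(u, v; k) = {γ ∈ ℤ : u^γ ~_{k,σ} v}` has at most one element. -/
theorem pseudo_orbit_subsingleton {k : Type*} [Field k] [CharZero k] (σ : RingAut k)
    (u v : k) (hu : u ≠ 0) (hv : v ≠ 0)
    (hrad : ¬ ∃ g : k, g ≠ 0 ∧ ∃ n : ℕ, 1 ≤ n ∧ σ g = u ^ n * g) :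
    Set.Subsingleton {γ : ℤ | ∃ w : k, w ≠ 0 ∧ u ^ γ = v * σ w / w} := by
  rintro a ⟨x, hx, hax⟩ b ⟨y, hy, hby⟩
  wlog hab : a < b generalizing a b x y
  · by_contra hne
    exact hne (this y hy hby x hx hax (by lia)).symm
  obtain ⟨n, rfl⟩ := Int.le.dest hab.le
  refine absurd ⟨y / x, div_ne_zero hy hx, n, by lia, ?_⟩ hrad
  have hσx : σ x ≠ 0 := (map_ne_zero σ).mpr hx
  rw [zpow_add₀ hu, zpow_natCast, hax] at hby
  rw [map_div₀]
  field_simp at hby ⊢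
  linear_combination -hby
end

section
/- Let K be a field of characteristic 0, σ a field automorphism of K, F a subfield of K with σ(F) = F, and x ∈ K with σ(x) = x (x may be algebraic or transcendental over F). Then the set of σ-fixed elements of the subfield F(x) of K generated by F and x equals the subfield of K generated by Const_σ(F) = {c ∈ F : σ(c) = c} and x; that is, Const_σ(F(x)) = (Const_σ F)(x). -/
/-- Applying a field automorphism to the coefficients of a linear combination of fixed elements
applies it to the value. -/
theorem linearCombination_mapRange_of_fixed {K ι : Type*} [Field K] (σ : RingAut K) {v : ι → K}
    (hv : ∀ i, σ (v i) = v i) (r : ι →₀ K) :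
    Finsupp.linearCombination K v (r.mapRange σ (map_zero σ)) =
      σ (Finsupp.linearCombination K v r) := by
  rw [Finsupp.linearCombination_apply, Finsupp.linearCombination_apply,
    Finsupp.sum_mapRange_index (by simp), Finsupp.sum, Finsupp.sum, map_sum]
  simp [hv]

/-- If a linear relation among `σ`-fixed elements `v`, with coefficients in a `σ`-stable subfield
`F`, does not annihilate a second family `w`, then there is such a relation
with coefficients in the `σ`-constants of `F`. -/
theorem exists_fixed_relation {K ι : Type*} [Field K] (σ : RingAut K) (F : Subfield K)
    (hF : ∀ c ∈ F, σ c ∈ F) {v w : ι → K} (hv : ∀ i, σ (v i) = v i)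
    (r : ι →₀ K) (hrF : ∀ i, r i ∈ F) (hrv : Finsupp.linearCombination K v r = 0)
    (hrw : Finsupp.linearCombination K w r ≠ 0) :
    ∃ s : ι →₀ K, (∀ i, s i ∈ F ∧ σ (s i) = s i) ∧ Finsupp.linearCombination K v s = 0 ∧
      Finsupp.linearCombination K w s ≠ 0 := by
  induction hn : r.support.card using Nat.strong_induction_on generalizing r with
  | _ n ih =>
  subst hn
  obtain ⟨j, hj⟩ : ∃ j, r j ≠ 0 := by
    by_contra! h
    exact hrw (by rw [show r = 0 from Finsupp.ext h, map_zero])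
  -- normalize the `j`-th coefficient to `1`
  set t : ι →₀ K := (r j)⁻¹ • r with ht
  have htF : ∀ i, t i ∈ F := fun i ↦ F.mul_mem (F.inv_mem (hrF j)) (hrF i)
  have htj : t j = 1 := inv_mul_cancel₀ hj
  have htv : Finsupp.linearCombination K v t = 0 := by rw [ht, map_smul, hrv, smul_zero]
  have htw : Finsupp.linearCombination K w t ≠ 0 := by
    rw [ht, map_smul]
    exact smul_ne_zero (inv_ne_zero hj) hrw
  have htr : ∀ i, r i = 0 → t i = 0 := fun i hi ↦ by simp [ht, hi]
  have hcard : ∀ (u : ι →₀ K) (k : ι), (∀ i, r i = 0 → u i = 0) → r k ≠ 0 → u k = 0 →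
      u.support.card < r.support.card := fun u k hu hk huk ↦ by
    refine Finset.card_lt_card ((Finset.ssubset_iff_of_subset fun i hi ↦ ?_).2 ⟨k, ?_, ?_⟩)
    · exact Finsupp.mem_support_iff.2 fun h ↦ Finsupp.mem_support_iff.1 hi (hu i h)
    · exact Finsupp.mem_support_iff.2 hk
    · simpa using huk
  set d : ι →₀ K := t - t.mapRange σ (map_zero σ) with hd
  have hdi : ∀ i, d i = t i - σ (t i) := fun i ↦ by simp [hd]
  have hdF : ∀ i, d i ∈ F := fun i ↦ by
    rw [hdi]
    exact F.sub_mem (htF i) (hF _ (htF i))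
  have hdr : ∀ i, r i = 0 → d i = 0 := fun i hi ↦ by simp [hdi, htr i hi]
  have hdv : Finsupp.linearCombination K v d = 0 := by
    rw [hd, map_sub, linearCombination_mapRange_of_fixed σ hv, htv, map_zero, sub_zero]
  by_cases hdw : Finsupp.linearCombination K w d = 0
  · by_cases hfix : ∀ i, d i = 0
    · exact ⟨t, fun i ↦ ⟨htF i, (sub_eq_zero.1 ((hdi i).symm.trans (hfix i))).symm⟩, htv, htw⟩
    · obtain ⟨k, hk⟩ := not_forall.1 hfix
      refine ih _ (hcard (t - (t k / d k) • d) k ?_ (fun h ↦ hk (hdr k h)) ?_) _ ?_ ?_ ?_ rfl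
      · intro i hi
        simp [htr i hi, hdr i hi]
      · simp [div_mul_cancel₀ _ hk]
      · exact fun i ↦ F.sub_mem (htF i) (F.mul_mem (F.div_mem (htF k) (hdF k)) (hdF i))
      · rw [map_sub, map_smul _ _ d, htv, hdv, smul_zero, sub_zero]
      · rwa [map_sub, map_smul _ _ d, hdw, smul_zero, sub_zero]
  · exact ih _ (hcard d j hdr hj (by simp [hdi, htj])) d hdF hdv hdw rfl

/-- Elements of the subfield generated by `F` and `x` are quotients of polynomial expressions
in `x` over `F`. -/
theorem exists_div_of_mem_closure_union_singleton {K : Type*} [Field K] {F : Subfield K}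
    {x y : K} (hy : y ∈ Subfield.closure ((F : Set K) ∪ {x})) :
    ∃ p q : Polynomial F, y = p.aeval x / q.aeval x := by
  refine (IntermediateField.mem_adjoin_simple_iff F y).1 ?_
  change y ∈ Subfield.closure (Set.range (algebraMap F K) ∪ {x})
  rwa [show Set.range (algebraMap F K) = (F : Set K) from Subtype.range_coe]

/-- Lemma `Lemma:XExt`: if `F` is a `σ`-stable subfield of `(K, σ)` and `x ∈ K` is fixed
by `σ` (algebraic or transcendental over `F`), then the `σ`-constants of `F(x)` form the
subfield `(Const_σ F)(x)`. -/
theorem constants_of_adjoin_fixed {K : Type*} [Field K] [CharZero K] (σ : RingAut K)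
    (F : Subfield K) (hF : F.map (σ : K →+* K) = F)
    (x : K) (hx : σ x = x) :
    {y : K | y ∈ Subfield.closure ((F : Set K) ∪ {x}) ∧ σ y = y}
      = (Subfield.closure ({c : K | c ∈ F ∧ σ c = c} ∪ {x}) : Set K) := by
  have hF' : ∀ c ∈ F, σ c ∈ F := fun c hc ↦ by
    have h : (σ : K →+* K) c ∈ F.map (σ : K →+* K) := Subfield.mem_map.2 ⟨c, hc, rfl⟩
    rwa [hF] at h
  ext y
  refine ⟨fun ⟨hy, hσy⟩ ↦ ?_, fun hy ↦ ⟨?_, ?_⟩⟩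
  · obtain ⟨p, q, hpq⟩ := exists_div_of_mem_closure_union_singleton hy
    by_cases hq : q.aeval x = 0
    · rw [hpq, hq, div_zero]
      exact Subfield.zero_mem _
    have hrel : y * q.aeval x = p.aeval x := by rw [hpq, div_mul_cancel₀ _ hq]
    -- the relation `y * q(x) - p(x) = 0` among the fixed elements `y * x ^ i` and `x ^ i`
    let v : Fin (q.natDegree + 1) ⊕ Fin (p.natDegree + 1) → K :=
      Sum.elim (fun i ↦ y * x ^ (i : ℕ)) (fun i ↦ -x ^ (i : ℕ))
    let w : Fin (q.natDegree + 1) ⊕ Fin (p.natDegree + 1) → K :=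
      Sum.elim (fun i ↦ x ^ (i : ℕ)) (fun _ ↦ 0)
    have hv (s) : Finsupp.linearCombination K v s =
        y * ∑ i, s (.inl i) * x ^ (i : ℕ) - ∑ i, s (.inr i) * x ^ (i : ℕ) := by
      rw [Finsupp.linearCombination_apply, Finsupp.sum_fintype _ _ (by simp),
        Fintype.sum_sum_type, Finset.mul_sum]
      simp [v, mul_left_comm, sub_eq_add_neg]
    have hw (s) : Finsupp.linearCombination K w s = ∑ i, s (.inl i) * x ^ (i : ℕ) := by
      rw [Finsupp.linearCombination_apply, Finsupp.sum_fintype _ _ (by simp),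
        Fintype.sum_sum_type]
      simp [w]
    have haeval (f : Polynomial F) :
        ∑ i : Fin (f.natDegree + 1), (f.coeff i : K) * x ^ (i : ℕ) = f.aeval x := by
      rw [Polynomial.aeval_eq_sum_range,
        Fin.sum_univ_eq_sum_range (fun i ↦ (f.coeff i : K) * x ^ i)]
      rfl
    obtain ⟨s, hs, hsv, hsw⟩ := exists_fixed_relation σ F hF' (v := v) (w := w)
      (by rintro (i | i) <;> simp [v, hσy, hx])
      (Finsupp.equivFunOnFinite.symm
        (Sum.elim (fun i ↦ (q.coeff i : K)) (fun i ↦ (p.coeff i : K))))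
      (by rintro (i | i) <;> simp)
      (by simp [hv, haeval, hrel])
      (by simpa [hw, haeval] using hq)
    rw [hv, sub_eq_zero] at hsv
    rw [hw] at hsw
    have hmem (j) (i : ℕ) :
        s j * x ^ i ∈ Subfield.closure ({c : K | c ∈ F ∧ σ c = c} ∪ {x}) :=
      Subfield.mul_mem _ (Subfield.subset_closure (.inl (hs j)))
        (pow_mem (Subfield.subset_closure (.inr rfl)) i)
    rw [SetLike.mem_coe, eq_div_of_mul_eq hsw hsv]
    exact Subfield.div_mem _ (sum_mem fun i _ ↦ hmem _ _) (sum_mem fun i _ ↦ hmem _ _)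
  · exact Subfield.closure_mono (Set.union_subset_union_left _ fun c hc ↦ hc.1) hy
  · refine Subfield.closure_induction (p := fun z _ ↦ σ z = z) ?_ (map_one σ) ?_ ?_ ?_ ?_ hy
    · rintro z (hz | rfl)
      exacts [hz.2, hx]
    · intro a b _ _ ha hb
      rw [map_add, ha, hb]
    · intro a _ ha
      rw [map_neg, ha]
    · intro a _ ha
      rw [map_inv₀, ha]
    · intro a b _ _ ha hb
      rw [map_mul, ha, hb]
end

section
/- Let F be a field of characteristic 0 and let A(x) be an r×s matrix with entries in the polynomial ring F[x]. Then there exist ν ∈ ℕ, vectors v_1(x), …, v_ν(x) ∈ F[x]^s, and δ ∈ ℕ such that: (a) v_1(x), …, v_ν(x) form a basis of the F[x]-module {v ∈ F[x]^s : A(x)·v = 0}; and (b) for every natural number n ≥ δ, the evaluated vectors v_1(n), …, v_ν(n) ∈ F^s form a basis of the F-vector space {v ∈ F^s : A(n)·v = 0}, where A(n) denotes the matrix obtained by evaluating every entry of A(x) at x = n. -/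
open Polynomial

/-- The kernel of a matrix over a principal ideal domain has a finite basis. -/
lemma exists_linearIndependent_span_eq_ker {R m n : Type*} [CommRing R] [IsDomain R]
    [IsPrincipalIdealRing R] [Fintype n] (A : Matrix m n R) :
    ∃ (ν : ℕ) (v : Fin ν → n → R), LinearIndependent R v ∧
      Submodule.span R (Set.range v) = LinearMap.ker A.mulVecLin := by
  obtain ⟨ν, ⟨b⟩⟩ : ∃ ν, Nonempty (Module.Basis (Fin ν) R (LinearMap.ker A.mulVecLin)) :=
    ⟨_, ⟨Module.finBasis _ _⟩⟩
  refine ⟨ν, (LinearMap.ker A.mulVecLin).subtype ∘ b,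
    b.linearIndependent.map' _ (Submodule.ker_subtype _), ?_⟩
  rw [Set.range_comp, ← Submodule.map_span, b.span_eq, Submodule.map_subtype_top]

section PolynomialVector

variable {F : Type*} [Field F]

/-- A polynomial vector vanishing at `a` is a multiple of `X - C a`. -/
lemma exists_eq_X_sub_C_smul_of_eval_eq_zero {ι : Type*} {a : F} {p : ι → F[X]}
    (h : ∀ i, (p i).eval a = 0) : ∃ q : ι → F[X], p = (X - C a) • q := by
  choose q hq using fun i => dvd_iff_isRoot.mpr (h i)
  exact ⟨q, funext hq⟩

lemma eval_mulVec {m n : Type*} [Fintype n] (A : Matrix m n F[X]) (p : n → F[X]) (a : F) (i : m) :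
    (A.mulVec p i).eval a =
      (A.map (fun q => q.eval a)).mulVec (fun j => (p j).eval a) i := by
  simp [Matrix.mulVec, dotProduct, eval_finsetSum]

/-- Some nonzero ring element carries the saturation of a submodule of a finite module into the
submodule. -/
lemma exists_ne_zero_forall_smul_mem_of_smul_mem {R M : Type*} [CommRing R] [IsDomain R]
    [IsNoetherianRing R] [AddCommGroup M] [Module R M] [Module.Finite R M] (N : Submodule R M) :
    ∃ d : R, d ≠ 0 ∧ ∀ c : R, c ≠ 0 → ∀ u : M, c • u ∈ N → d • u ∈ N := by
  obtain ⟨d, hd, hd0⟩ := Submodule.annihilator_top_inter_nonZeroDivisors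
    (Submodule.torsion_isTorsion (R := R) (M := M ⧸ N))
  refine ⟨d, nonZeroDivisors.ne_zero hd0, fun c hc u hu => ?_⟩
  have hmem : N.mkQ u ∈ Submodule.torsion R (M ⧸ N) :=
    ⟨⟨c, mem_nonZeroDivisors_of_ne_zero hc⟩, by
      change c • N.mkQ u = 0
      rwa [← map_smul, Submodule.mkQ_apply, Submodule.Quotient.mk_eq_zero]⟩
  have h := Submodule.mem_annihilator.mp hd ⟨N.mkQ u, hmem⟩ trivial
  have h' : d • N.mkQ u = 0 := congrArg Subtype.val h
  rwa [← map_smul, Submodule.mkQ_apply, Submodule.Quotient.mk_eq_zero] at h'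

/-- A basis of the kernel of a polynomial matrix stays linearly independent when evaluated. -/
lemma linearIndependent_eval_of_span_eq_ker {ι m n : Type*} [Fintype ι] [Fintype n]
    {A : Matrix m n F[X]} {v : ι → n → F[X]} (hv : LinearIndependent F[X] v)
    (hspan : Submodule.span F[X] (Set.range v) = LinearMap.ker A.mulVecLin) (a : F) :
    LinearIndependent F (fun i j => (v i j).eval a) := by
  rw [Fintype.linearIndependent_iff]
  intro g hg
  obtain ⟨u, hu⟩ := exists_eq_X_sub_C_smul_of_eval_eq_zero (a := a)
    (p := ∑ i, C (g i) • v i) fun j => by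
      simpa [eval_finsetSum] using congrFun hg j
  have hmem : (X - C a) • u ∈ LinearMap.ker A.mulVecLin := by
    rw [← hu, ← hspan]
    exact Submodule.sum_mem _ fun i _ =>
      Submodule.smul_mem _ _ (Submodule.subset_span ⟨i, rfl⟩)
  have hker : u ∈ Submodule.span F[X] (Set.range v) := by
    rw [hspan]
    rw [LinearMap.mem_ker, map_smul] at hmem
    exact (smul_eq_zero.mp hmem).resolve_left (X_sub_C_ne_zero a)
  obtain ⟨c, rfl⟩ := (Submodule.mem_span_range_iff_exists_fun F[X]).mp hker
  have hzero : ∑ i, (C (g i) - (X - C a) * c i) • v i = 0 := by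
    simp only [sub_smul, Finset.sum_sub_distrib, hu, Finset.smul_sum, mul_smul, sub_self]
  intro i
  simpa using congrArg (eval a) (Fintype.linearIndependent_iff.mp hv _ hzero i)

/-- If `d` is nonzero at `a` and carries the saturation of the range of `A` into the range, then
evaluating generators of the kernel of `A` at `a` gives generators of the kernel of `A(a)`. -/
lemma span_eval_eq_ker {ι m n : Type*} [Fintype ι] [Fintype n]
    {A : Matrix m n F[X]} {v : ι → n → F[X]}
    (hspan : Submodule.span F[X] (Set.range v) = LinearMap.ker A.mulVecLin) {a : F} {d : F[X]}
    (hd : ∀ c : F[X], c ≠ 0 → ∀ u : m → F[X],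
      c • u ∈ LinearMap.range A.mulVecLin → d • u ∈ LinearMap.range A.mulVecLin)
    (hda : d.eval a ≠ 0) :
    Submodule.span F (Set.range (fun i j => (v i j).eval a)) =
      LinearMap.ker ((A.map (fun p => p.eval a)).mulVecLin) := by
  apply le_antisymm
  · rw [Submodule.span_le]
    rintro _ ⟨i, rfl⟩
    have hi : v i ∈ LinearMap.ker A.mulVecLin := hspan ▸ Submodule.subset_span ⟨i, rfl⟩
    rw [LinearMap.mem_ker, Matrix.mulVecLin_apply] at hi
    ext k
    simpa [hi] using (eval_mulVec A (v i) a k).symm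
  · intro w hw
    rw [LinearMap.mem_ker, Matrix.mulVecLin_apply] at hw
    obtain ⟨u, hu⟩ := exists_eq_X_sub_C_smul_of_eval_eq_zero (a := a)
      (p := A.mulVec fun j => C (w j)) fun k => by
        rw [eval_mulVec]
        simpa using congrFun hw k
    obtain ⟨z, hz⟩ := hd _ (X_sub_C_ne_zero a) u ⟨_, hu⟩
    rw [Matrix.mulVecLin_apply] at hz
    have hker : d • (fun j => C (w j)) - (X - C a) • z ∈ Submodule.span F[X] (Set.range v) := by
      rw [hspan, LinearMap.mem_ker, Matrix.mulVecLin_apply, Matrix.mulVec_sub, Matrix.mulVec_smul,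
        Matrix.mulVec_smul, hu, hz, smul_comm, sub_self]
    obtain ⟨c, hc⟩ := (Submodule.mem_span_range_iff_exists_fun F[X]).mp hker
    rw [← Submodule.smul_mem_iff _ hda, Submodule.mem_span_range_iff_exists_fun]
    refine ⟨fun i => (c i).eval a, ?_⟩
    ext j
    simpa [eval_finsetSum] using congrArg (eval a) (congrFun hc j)

lemma exists_forall_natCast_eval_ne_zero [CharZero F] {d : F[X]} (hd : d ≠ 0) :
    ∃ δ : ℕ, ∀ n : ℕ, δ ≤ n → d.eval (n : F) ≠ 0 := by
  obtain ⟨b, hb⟩ := ((Polynomial.finite_setOfPred_isRoot hd).preimage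
    (Nat.cast_injective (R := F)).injOn).bddAbove
  exact ⟨b + 1, fun n hn h => absurd (hb (a := n) h) (by omega)⟩

end PolynomialVector

/-- Lemma `Lemma:NullSpace`: for a matrix `A(x)` of polynomials over a field `F` of
characteristic zero, one can find an `F[x]`-basis `v_1(x), …, v_ν(x)` of `Ker A(x)` and a
bound `δ ∈ ℕ` such that for every `n ≥ δ` the evaluated vectors `v_1(n), …, v_ν(n)` form
an `F`-basis of `Ker A(n)`. -/
theorem nullspace_specialization {F : Type*} [Field F] [CharZero F] (r s : ℕ)
    (A : Matrix (Fin r) (Fin s) (Polynomial F)) :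
    ∃ (ν : ℕ) (v : Fin ν → (Fin s → Polynomial F)) (δ : ℕ),
      (LinearIndependent (Polynomial F) v ∧
        Submodule.span (Polynomial F) (Set.range v) = LinearMap.ker A.mulVecLin) ∧
      ∀ n : ℕ, δ ≤ n →
        (LinearIndependent F (fun i => fun j => (v i j).eval (n : F)) ∧
          Submodule.span F (Set.range (fun i => fun j => (v i j).eval (n : F)))
            = LinearMap.ker ((A.map (fun p => p.eval (n : F))).mulVecLin)) := by
  obtain ⟨ν, v, hli, hspan⟩ := exists_linearIndependent_span_eq_ker A
  obtain ⟨d, hd0, hd⟩ :=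
    exists_ne_zero_forall_smul_mem_of_smul_mem (LinearMap.range A.mulVecLin)
  obtain ⟨δ, hδ⟩ := exists_forall_natCast_eval_ne_zero hd0
  exact ⟨ν, v, δ, ⟨hli, hspan⟩, fun n hn =>
    ⟨linearIndependent_eval_of_span_eq_ker hli hspan n, span_eval_eq_ker hspan hd (hδ n hn)⟩⟩
end

section
/- Let (k, σ) be a difference field with C = Const_σ(k), let K be an algebraic field extension of k, and let σ_K be a field automorphism of K with σ_K(u) = σ(u) for all u ∈ k. Assume K is generated as a field over k by a set S of elements fixed by σ_K (i.e., σ_K(s) = s for all s ∈ S, and the smallest intermediate field of K/k containing S is K). Let ℓ, m ∈ ℕ, let a = (a_0, …, a_ℓ) ∈ k^{ℓ+1} be nonzero and b = (b_1, …, b_m) ∈ k^m, and for L ∈ {k, K} define the solution space V(a, b, L) := {(g, c_1, …, c_m) ∈ L × Const(L)^m : Σ_{i=0}^{ℓ} a_i·σ_L^i(g) = Σ_{j=1}^{m} c_j·b_j}, a vector space over Const(L). If f_1, …, f_n ∈ k × C^m form a C-basis of V(a, b, k), then their images in K × Const_{σ_K}(K)^m form a Const_{σ_K}(K)-basis of V(a,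 b, K); in particular, V(a, b, K) = {κ_1 f_1 + ⋯ + κ_n f_n : κ_1, …, κ_n ∈ Const_{σ_K}(K)}. -/
open Finset

section DifferenceFieldExtension

variable {k K : Type*} [Field k] [Field K] [Algebra k K]

/-- An algebraic extension generated by fixed points of `σK` has a basis of fixed points. -/
theorem exists_basis_fixed_of_adjoin_eq_top [Algebra.IsAlgebraic k K] (σK : RingAut K)
    (S : Set K) (hSfix : ∀ s ∈ S, σK s = s) (hSgen : IntermediateField.adjoin k S = ⊤) :
    ∃ (B : Set K) (e : Module.Basis B k K), ∀ i, σK (e i) = e i := by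
  have hadj : Algebra.adjoin k S = ⊤ := by
    rw [← IntermediateField.adjoin_toSubalgebra, hSgen, IntermediateField.top_toSubalgebra]
  have hspan : ⊤ ≤ Submodule.span k (Submonoid.closure S : Set K) := by
    rw [← Algebra.adjoin_eq_span, hadj, Algebra.top_toSubmodule]
  have hfix : ∀ x ∈ Submonoid.closure S, σK x = x := fun x hx => by
    induction hx using Submonoid.closure_induction with
    | mem x hx => exact hSfix x hx
    | one => exact map_one σK
    | mul x y _ _ hx hy => rw [map_mul, hx, hy]
  exact ⟨_, Module.Basis.ofSpan hspan, fun i =>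
    hfix _ (Module.Basis.ofSpan_subset hspan (Set.mem_range_self i))⟩

variable {ι : Type*} {σ : RingAut k} {σK : RingAut K} (e : Module.Basis ι k K)

/-- With respect to a basis of fixed points, `σK` acts coordinatewise as `σ`. -/
theorem repr_map_of_fixed_basis (hcompat : ∀ u, σK (algebraMap k K u) = algebraMap k K (σ u))
    (he : ∀ i, σK (e i) = e i) (u : K) (i : ι) : e.repr (σK u) i = σ (e.repr u i) := by
  obtain ⟨v, rfl⟩ := e.repr.symm.surjective u
  induction v using Finsupp.induction_linear with
  | zero => simp
  | add v w hv hw => simp only [map_add, Finsupp.add_apply, hv, hw]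
  | single j r =>
    classical
    have hsmul : σK (r • e j) = σ r • e j := by simp only [Algebra.smul_def, map_mul, hcompat, he]
    rw [e.repr_symm_single, hsmul]
    simp [Finsupp.single_apply, apply_ite σ]

theorem repr_pow_map_of_fixed_basis
    (hcompat : ∀ u, σK (algebraMap k K u) = algebraMap k K (σ u))
    (he : ∀ i, σK (e i) = e i) (x : ℕ) (u : K) (i : ι) :
    e.repr ((σK ^ x) u) i = (σ ^ x) (e.repr u i) := by
  induction x with
  | zero => rfl
  | succ x ih =>
    rw [pow_succ', pow_succ', RingAut.mul_apply, RingAut.mul_apply,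
      repr_map_of_fixed_basis e hcompat he, ih]

theorem repr_algebraMap_mul (r : k) (u : K) (i : ι) :
    e.repr (algebraMap k K r * u) i = r * e.repr u i := by
  simp [← Algebra.smul_def]

theorem repr_mul_algebraMap (r : k) (u : K) (i : ι) :
    e.repr (u * algebraMap k K r) i = e.repr u i * r := by
  rw [mul_comm, repr_algebraMap_mul, mul_comm]

/-- An element supported on `T` whose coordinates there are `k`-combinations of `r` is a
`K`-combination of `r`, the coefficients being assembled coordinatewise. -/
theorem eq_sum_mul_algebraMap_of_repr {n : ℕ} (T : Finset ι) (κ : ι → Fin n → k) (r : Fin n → k)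
    (u : K) (hT : (e.repr u).support ⊆ T) (hu : ∀ i, e.repr u i = ∑ l, κ i l * r l) :
    u = ∑ l, (∑ i ∈ T, algebraMap k K (κ i l) * e i) * algebraMap k K (r l) := by
  calc u = ∑ i ∈ T, e.repr u i • e i := by
        conv_lhs => rw [← e.linearCombination_repr u]
        exact Finsupp.sum_of_support_subset _ hT _ (fun i _ => zero_smul k _)
    _ = ∑ i ∈ T, ∑ l, algebraMap k K (κ i l) * e i * algebraMap k K (r l) := by
        refine Finset.sum_congr rfl fun i _ => ?_
        rw [hu, Algebra.smul_def, map_sum, Finset.sum_mul]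
        exact Finset.sum_congr rfl fun l _ => by rw [map_mul]; ring
    _ = _ := by simp_rw [Finset.sum_mul]; exact Finset.sum_comm

end DifferenceFieldExtension

/-- Proposition `Prop:AlgebraicPLDE`: let `(K, σK)` be an algebraic difference field
extension of `(k, σ)` generated by a set `S` of `σK`-fixed elements. If
`f_1, …, f_n ∈ k × C^m` (with `C = Const_σ(k)`) form a `C`-basis of the solution space
`V(a, b, k)` of the parameterized linear difference equation
`Σ_{i=0}^ℓ a_i σ^i(g) = Σ_{j=1}^m c_j b_j`, then their images in `K × Const_{σK}(K)^m`
form a `Const_{σK}(K)`-basis of `V(a, b, K)`; in particular every solution over `K` is a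
`Const_{σK}(K)`-linear combination of `f_1, …, f_n`. Membership, spanning and linear
independence of a basis are stated explicitly. -/
theorem plde_solutions_algebraic_constant_extension {k K : Type*}
    [Field k] [CharZero k] [Field K] [Algebra k K] [Algebra.IsAlgebraic k K]
    (σ : RingAut k) (σK : RingAut K)
    (hcompat : ∀ u : k, σK (algebraMap k K u) = algebraMap k K (σ u))
    (S : Set K) (hSfix : ∀ s ∈ S, σK s = s)
    (hSgen : IntermediateField.adjoin k S = ⊤)
    (ℓ m : ℕ) (a : Fin (ℓ + 1) → k) (ha : a ≠ 0) (b : Fin m → k)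
    (n : ℕ) (f : Fin n → k × (Fin m → k))
    (hmem : ∀ i, (∀ j, σ ((f i).2 j) = (f i).2 j) ∧
      ∑ x : Fin (ℓ + 1), a x * (σ ^ (x : ℕ)) (f i).1 = ∑ j, (f i).2 j * b j)
    (hspan : ∀ (g : k) (c : Fin m → k), (∀ j, σ (c j) = c j) →
      (∑ x : Fin (ℓ + 1), a x * (σ ^ (x : ℕ)) g = ∑ j, c j * b j) →
      ∃ κ : Fin n → k, (∀ i, σ (κ i) = κ i) ∧
        g = ∑ i, κ i * (f i).1 ∧ ∀ j, c j = ∑ i, κ i * (f i).2 j)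
    (hind : ∀ κ : Fin n → k, (∀ i, σ (κ i) = κ i) →
      (∑ i, κ i * (f i).1 = 0 ∧ ∀ j, ∑ i, κ i * (f i).2 j = 0) → κ = 0) :
    (∀ i, (∀ j, σK (algebraMap k K ((f i).2 j)) = algebraMap k K ((f i).2 j)) ∧
      ∑ x : Fin (ℓ + 1), algebraMap k K (a x) * (σK ^ (x : ℕ)) (algebraMap k K (f i).1)
        = ∑ j, algebraMap k K ((f i).2 j) * algebraMap k K (b j)) ∧
    (∀ (g : K) (c : Fin m → K), (∀ j, σK (c j) = c j) →
      (∑ x : Fin (ℓ + 1), algebraMap k K (a x) * (σK ^ (x : ℕ)) g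
        = ∑ j, c j * algebraMap k K (b j)) →
      ∃ κ : Fin n → K, (∀ i, σK (κ i) = κ i) ∧
        g = ∑ i, κ i * algebraMap k K (f i).1 ∧
        ∀ j, c j = ∑ i, κ i * algebraMap k K ((f i).2 j)) ∧
    (∀ κ : Fin n → K, (∀ i, σK (κ i) = κ i) →
      (∑ i, κ i * algebraMap k K (f i).1 = 0 ∧
        ∀ j, ∑ i, κ i * algebraMap k K ((f i).2 j) = 0) → κ = 0) := by
  have hcompat_pow : ∀ (x : ℕ) (u : k),
      (σK ^ x) (algebraMap k K u) = algebraMap k K ((σ ^ x) u) := fun x u => by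
    induction x with
    | zero => rfl
    | succ x ih => rw [pow_succ', pow_succ', RingAut.mul_apply, RingAut.mul_apply, ih, hcompat]
  obtain ⟨B, e, he⟩ := exists_basis_fixed_of_adjoin_eq_top σK S hSfix hSgen
  have hconst : ∀ u : K, σK u = u → ∀ i, σ (e.repr u i) = e.repr u i := fun u hu i => by
    rw [← repr_map_of_fixed_basis e hcompat he, hu]
  refine ⟨fun i => ⟨fun j => by rw [hcompat, (hmem i).1 j], ?_⟩, fun g c hc hg => ?_,
    fun κ hκ h => ?_⟩
  · simp_rw [hcompat_pow, ← map_mul, ← map_sum, (hmem i).2]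
  · have hcoord : ∀ i, ∑ x : Fin (ℓ + 1), a x * (σ ^ (x : ℕ)) (e.repr g i)
        = ∑ j, e.repr (c j) i * b j := fun i => by
      have h := congrArg (fun u => e.repr u i) hg
      simpa only [map_sum, Finsupp.finsetSum_apply, repr_algebraMap_mul, repr_mul_algebraMap,
        repr_pow_map_of_fixed_basis e hcompat he] using h
    choose κ hκ hκg hκc using fun i => hspan (e.repr g i) (fun j => e.repr (c j) i)
      (fun j => hconst (c j) (hc j) i) (hcoord i)
    classical
    let T : Finset B := (e.repr g).support ∪ univ.biUnion fun j => (e.repr (c j)).support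
    refine ⟨fun l => ∑ i ∈ T, algebraMap k K (κ i l) * e i, fun l => ?_, ?_, fun j => ?_⟩
    · simp_rw [map_sum, map_mul, hcompat, he, hκ]
    · exact eq_sum_mul_algebraMap_of_repr e T κ _ g subset_union_left hκg
    · exact eq_sum_mul_algebraMap_of_repr e T κ _ (c j)
        ((subset_biUnion_of_mem (fun j => (e.repr (c j)).support) (mem_univ j)).trans
          subset_union_right) fun i => hκc i j
  · have hcoord : ∀ i, (fun l => e.repr (κ l) i) = 0 := fun i => by
      refine hind _ (fun l => hconst (κ l) (hκ l) i) ⟨?_, fun j => ?_⟩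
      · simpa [repr_mul_algebraMap] using congrArg (fun u => e.repr u i) h.1
      · simpa [repr_mul_algebraMap] using congrArg (fun u => e.repr u i) (h.2 j)
    funext l
    exact e.ext_elem fun i => by simpa using congrFun (hcoord i) l
end
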